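/- arXiv:2503.16306 — 4 statements merged into one kernel-verified Lean document; each statement's English description precedes it below -/
import Mathlib

section
/- Let D be the six-sided die with faces {1,1,4,4,5,6} and G the six-sided die with faces {0,1,2,6,6,6}, each rolled uniformly at random. For a positive integer k, let D[k] and G[k] denote the sums of k independent rolls of D and G respectively. Then D[k] beats G[k] (i.e., P(D[k] > G[k]) > P(D[k] < G[k])) if and only if k = 4, and for every positive integer k ≠ 4, G[k] beats D[k] (i.e., P(G[k] > D[k]) > P(G[k] < D[k])). -/
-- The probability of an event `p` under the uniform distribution on a finite
-- sample space `Ω`, as a rational number.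
open Classical in
noncomputable def prob {Ω : Type*} [Fintype Ω] (p : Ω → Prop) : ℚ :=
  ((Finset.univ.filter p).card : ℚ) / (Fintype.card Ω : ℚ)

/-- The sum of the face values of a die `D` (a function from a finite index type
of faces to values) along a sequence of `k` rolls `f`. -/
def sumRolls {ι : Type*} (D : ι → ℤ) {k : ℕ} (f : Fin k → ι) : ℤ :=
  ∑ i, D (f i)

/-- `Beats A B k` : after summing `k` independent uniform rolls of each die,
`A` is strictly more likely to show the larger total than `B`. -/
def Beats {ι κ : Type*} [Fintype ι] [Fintype κ] (A : ι → ℤ) (B : κ → ℤ) (k : ℕ) : Prop :=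
  prob (fun p : (Fin k → ι) × (Fin k → κ) => sumRolls B p.2 < sumRolls A p.1) >
    prob (fun p : (Fin k → ι) × (Fin k → κ) => sumRolls A p.1 < sumRolls B p.2)

/-- The die David, with faces {1,1,4,4,5,6}. -/
def David : Fin 6 → ℤ := ![1, 1, 4, 4, 5, 6]

/-- The die Goliath, with faces {0,1,2,6,6,6}. -/
def Goliath : Fin 6 → ℤ := ![0, 1, 2, 6, 6, 6]

/-- The amount by which David's total exceeds Goliath's on a given pair of roll sequences. -/
def lead {k : ℕ} (p : (Fin k → Fin 6) × (Fin k → Fin 6)) : ℤ :=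
  sumRolls David p.1 - sumRolls Goliath p.2

lemma beats_iff {ι κ : Type*} [Fintype ι] [Fintype κ] [Nonempty ι] [Nonempty κ]
    (A : ι → ℤ) (B : κ → ℤ) (k : ℕ) :
    Beats A B k ↔
      (Finset.univ.filter fun p : (Fin k → ι) × (Fin k → κ) =>
        sumRolls A p.1 < sumRolls B p.2).card <
      (Finset.univ.filter fun p : (Fin k → ι) × (Fin k → κ) =>
        sumRolls B p.2 < sumRolls A p.1).card := by
  classical
  have h : (0 : ℚ) < Fintype.card ((Fin k → ι) × (Fin k → κ)) := by
    exact_mod_cast Fintype.card_pos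
  unfold Beats prob
  rw [gt_iff_lt, div_lt_div_iff_of_pos_right h, Nat.cast_lt]
  convert Iff.rfl

lemma david_beats_iff (k : ℕ) :
    Beats David Goliath k ↔
      (Finset.univ.filter fun p : (Fin k → Fin 6) × (Fin k → Fin 6) => lead p < 0).card <
      (Finset.univ.filter fun p : (Fin k → Fin 6) × (Fin k → Fin 6) => 0 < lead p).card := by
  rw [beats_iff]
  simp only [lead, sub_neg, sub_pos]

lemma goliath_beats_iff (k : ℕ) :
    Beats Goliath David k ↔
      (Finset.univ.filter fun p : (Fin k → Fin 6) × (Fin k → Fin 6) => 0 < lead p).card <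
      (Finset.univ.filter fun p : (Fin k → Fin 6) × (Fin k → Fin 6) => lead p < 0).card := by
  rw [beats_iff]
  simp only [lead, sub_neg, sub_pos]
  rw [← Finset.card_map (Equiv.prodComm _ _).toEmbedding,
    ← Finset.card_map (s := Finset.univ.filter fun p : (Fin k → Fin 6) × (Fin k → Fin 6) =>
        sumRolls David p.2 < sumRolls Goliath p.1) (Equiv.prodComm _ _).toEmbedding]
  convert Iff.rfl using 3 <;>
  · ext ⟨a, b⟩
    simp

lemma sum_prod_mul_prod {R ι κ : Type*} [CommSemiring R] [Fintype ι] [Fintype κ]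
    (f : ι → R) (g : κ → R) (k : ℕ) :
    ∑ p : (Fin k → ι) × (Fin k → κ), (∏ i, f (p.1 i)) * ∏ i, g (p.2 i) =
      ((∑ a, f a) * ∑ b, g b) ^ k := by
  rw [mul_pow, Fintype.sum_pow, Fintype.sum_pow, Finset.sum_mul_sum, Fintype.sum_prod_type]

section Kronecker

variable {S : Type*} [Fintype S] (e : S → ℕ) (B M : ℕ)

/-- If the number `∑ B ^ e s` is read in base `B`, with `B` exceeding the number of summands,
then the digits above position `M` count the `s` with `M < e s`. -/
lemma card_lt_eq_mod (hB : Fintype.card S + 1 < B) :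
    (Finset.univ.filter fun s => M < e s).card = ((∑ s, B ^ e s) / B ^ (M + 1)) % (B - 1) := by
  have hB0 : 0 < B := by omega
  have h₁ : ∑ s, B ^ e s =
      B ^ (M + 1) * (∑ s with M < e s, B ^ (e s - (M + 1))) + ∑ s with ¬ M < e s, B ^ e s := by
    rw [← Finset.sum_filter_add_sum_filter_not Finset.univ (fun s => M < e s), Finset.mul_sum]
    congr 1
    refine Finset.sum_congr rfl fun s hs => ?_
    rw [← pow_add, Nat.add_sub_cancel' (by simpa using hs)]
  have h₂ : ∑ s with ¬ M < e s, B ^ e s < B ^ (M + 1) := by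
    calc ∑ s with ¬ M < e s, B ^ e s
        ≤ ∑ s with ¬ M < e s, B ^ M := Finset.sum_le_sum fun s hs =>
          Nat.pow_le_pow_right hB0 (by simpa using hs)
      _ ≤ Fintype.card S * B ^ M := by
          rw [Finset.sum_const, smul_eq_mul]
          exact Nat.mul_le_mul_right _ (Finset.card_le_univ _)
      _ < B * B ^ M := Nat.mul_lt_mul_of_pos_right (by omega) (by positivity)
      _ = B ^ (M + 1) := by ring
  rw [h₁, Nat.mul_add_div (by positivity), Nat.div_eq_of_lt h₂, add_zero]
  have h₃ : ∑ s with M < e s, B ^ (e s - (M + 1)) ≡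
      ∑ s with M < e s, 1 [MOD (B - 1)] := by
    refine Nat.ModEq.sum fun s _ => ?_
    have : B ≡ 1 [MOD (B - 1)] := ((Nat.modEq_iff_dvd' (by omega)).2 dvd_rfl).symm
    simpa using this.pow (e s - (M + 1))
  have h₄ := Finset.card_le_univ (Finset.univ.filter fun s => M < e s)
  rw [h₃, Finset.sum_const, smul_eq_mul, mul_one, Nat.mod_eq_of_lt (by omega)]

/-- The digits below position `M` count the `s` with `e s < M`. -/
lemma card_gt_eq_mod (hB : Fintype.card S + 1 < B) :
    (Finset.univ.filter fun s => e s < M).card = ((∑ s, B ^ e s) % B ^ M) % (B - 1) := by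
  have hB0 : 0 < B := by omega
  have h₁ : ∑ s, B ^ e s =
      (∑ s with e s < M, B ^ e s) + B ^ M * ∑ s with ¬ e s < M, B ^ (e s - M) := by
    rw [← Finset.sum_filter_add_sum_filter_not Finset.univ (fun s => e s < M), Finset.mul_sum]
    congr 1
    refine Finset.sum_congr rfl fun s hs => ?_
    rw [← pow_add, Nat.add_sub_cancel' (by simpa using hs)]
  have h₂ : ∑ s with e s < M, B ^ e s < B ^ M := by
    rcases M with _ | M
    · simp
    calc ∑ s with e s < M + 1, B ^ e s
        ≤ ∑ s with e s < M + 1, B ^ M := Finset.sum_le_sum fun s hs =>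
          Nat.pow_le_pow_right hB0 (Nat.le_of_lt_succ (by simpa using hs))
      _ ≤ Fintype.card S * B ^ M := by
          rw [Finset.sum_const, smul_eq_mul]
          exact Nat.mul_le_mul_right _ (Finset.card_le_univ _)
      _ < B * B ^ M := Nat.mul_lt_mul_of_pos_right (by omega) (by positivity)
      _ = B ^ (M + 1) := by ring
  rw [h₁, Nat.add_mul_mod_self_left, Nat.mod_eq_of_lt h₂]
  have h₃ : ∑ s with e s < M, B ^ e s ≡ ∑ s with e s < M, 1 [MOD (B - 1)] := by
    refine Nat.ModEq.sum fun s _ => ?_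
    have : B ≡ 1 [MOD (B - 1)] := ((Nat.modEq_iff_dvd' (by omega)).2 dvd_rfl).symm
    simpa using this.pow (e s)
  have h₄ := Finset.card_le_univ (Finset.univ.filter fun s => e s < M)
  rw [h₃, Finset.sum_const, smul_eq_mul, mul_one, Nat.mod_eq_of_lt (by omega)]

end Kronecker

/-- The generating function of `lead + 6` for a single roll, evaluated at `B`. -/
def leadGen (B : ℕ) : ℕ :=
  (2 * B + 2 * B ^ 4 + B ^ 5 + B ^ 6) * (3 + B ^ 4 + B ^ 5 + B ^ 6)

lemma sum_pow_lead (B k : ℕ) :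
    ∑ p : (Fin k → Fin 6) × (Fin k → Fin 6), B ^ (lead p + 6 * k).toNat = leadGen B ^ k := by
  have h : leadGen B = (∑ a, B ^ (David a).toNat) * ∑ b, B ^ (6 - Goliath b).toNat := by
    simp [leadGen, Fin.sum_univ_six, David, Goliath]
    ring
  rw [h, ← sum_prod_mul_prod]
  refine Finset.sum_congr rfl fun p _ => ?_
  rw [Finset.prod_pow_eq_pow_sum, Finset.prod_pow_eq_pow_sum, ← pow_add]
  congr 1
  zify
  have h₁ : ∀ a, 0 ≤ David a := by decide
  have h₂ : ∀ a, 0 ≤ 6 - Goliath a := by decide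
  have h₃ : lead p + 6 * k = ∑ i, David (p.1 i) + ∑ i, (6 - Goliath (p.2 i)) := by
    simp [lead, sumRolls]
    ring
  rw [h₃]
  simp only [Int.toNat_of_nonneg, h₁, h₂]
  exact Int.toNat_of_nonneg
    (add_nonneg (Finset.sum_nonneg fun i _ => h₁ _) (Finset.sum_nonneg fun i _ => h₂ _))

lemma neg_six_mul_le_lead {k : ℕ} (p : (Fin k → Fin 6) × (Fin k → Fin 6)) :
    0 ≤ lead p + 6 * k := by
  have h₁ : ∀ a, 0 ≤ David a := by decide
  have h₂ : ∀ a, 0 ≤ 6 - Goliath a := by decide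
  have h₃ : lead p + 6 * k = ∑ i, David (p.1 i) + ∑ i, (6 - Goliath (p.2 i)) := by
    simp [lead, sumRolls]
    ring
  rw [h₃]
  exact add_nonneg (Finset.sum_nonneg fun i _ => h₁ _) (Finset.sum_nonneg fun i _ => h₂ _)

lemma card_add_one_lt {k : ℕ} (hk : 0 < k) :
    Fintype.card ((Fin k → Fin 6) × (Fin k → Fin 6)) + 1 < 64 ^ k := by
  have h : Fintype.card ((Fin k → Fin 6) × (Fin k → Fin 6)) = 36 ^ k := by
    simp [← mul_pow]
  have h₁ : 36 ^ k + 1 ^ k < 64 ^ k :=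
    (pow_add_pow_le (by norm_num) (by norm_num) hk.ne').trans_lt
      (Nat.pow_lt_pow_left (by norm_num) hk.ne')
  simpa [h] using h₁

lemma card_lead_pos {k : ℕ} (hk : 0 < k) :
    (Finset.univ.filter fun p : (Fin k → Fin 6) × (Fin k → Fin 6) => 0 < lead p).card =
      leadGen (64 ^ k) ^ k / (64 ^ k) ^ (6 * k + 1) % (64 ^ k - 1) := by
  rw [← sum_pow_lead, ← card_lt_eq_mod _ _ _ (card_add_one_lt hk)]
  congr 1
  ext p
  simp

lemma card_lead_neg {k : ℕ} (hk : 0 < k) :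
    (Finset.univ.filter fun p : (Fin k → Fin 6) × (Fin k → Fin 6) => lead p < 0).card =
      leadGen (64 ^ k) ^ k % (64 ^ k) ^ (6 * k) % (64 ^ k - 1) := by
  rw [← sum_pow_lead, ← card_gt_eq_mod _ _ _ (card_add_one_lt hk)]
  congr 1
  ext p
  have := neg_six_mul_le_lead p
  simp
  omega

/-- The first `k` values: by exact evaluation of the generating function. -/
lemma small_cases : ∀ k < 150, 0 < k → k ≠ 4 →
    leadGen (64 ^ k) ^ k / (64 ^ k) ^ (6 * k + 1) % (64 ^ k - 1) <
      leadGen (64 ^ k) ^ k % (64 ^ k) ^ (6 * k) % (64 ^ k - 1) := by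
  decide +kernel

lemma four_rolls :
    leadGen (64 ^ 4) ^ 4 % (64 ^ 4) ^ (6 * 4) % (64 ^ 4 - 1) <
    leadGen (64 ^ 4) ^ 4 / (64 ^ 4) ^ (6 * 4 + 1) % (64 ^ 4 - 1) := by
  decide +kernel

lemma six_le_imQuartic {x : ℝ} (h₁ : 955/1000 ≤ x) (h₂ : x ≤ 1) :
    6 ≤ 32 * x ^ 4 - 32 * x ^ 3 - 32 * x ^ 2 + 28 * x + 10 := by
  obtain ⟨u, rfl⟩ : ∃ u, x = 1 - u := ⟨1 - x, by ring⟩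
  have hu : 0 ≤ u := by linarith
  have hv : 0 ≤ 9/200 - u := by linarith
  nlinarith [mul_nonneg hu hv, mul_nonneg hu hu, mul_nonneg (mul_nonneg hu hu) hv,
      pow_nonneg hu 3, pow_nonneg hu 4]

lemma imQuartic_le_twelve {x : ℝ} (h₁ : 955/1000 ≤ x) (h₂ : x ≤ 1) :
    32 * x ^ 4 - 32 * x ^ 3 - 32 * x ^ 2 + 28 * x + 10 ≤ 12 := by
  nlinarith [pow_nonneg (by linarith : 0 ≤ x) 3]

lemma le_re_poly {x : ℝ} (h₁ : 955/1000 ≤ x) (h₂ : x ≤ 1) :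
    1 - 61/6 * (1 - x) ≤ (5 + 7 * x + 8 * (2 * x * x - 1) + 3 * (4 * x ^ 3 - 3 * x) +
        4 * (8 * x ^ 4 - 8 * x * x + 1) + 8 * (16 * x ^ 5 - 20 * x ^ 3 + 5 * x) +
        (32 * x ^ 6 - 48 * x ^ 4 + 18 * x * x - 1))/36 := by
  obtain ⟨u, rfl⟩ : ∃ u, x = 1 - u := ⟨1 - x, by ring⟩
  have hu : 0 ≤ u := by linarith
  have hv : 0 ≤ 9/200 - u := by linarith
  nlinarith [mul_nonneg hu hv, mul_nonneg hu hu, mul_nonneg (mul_nonneg hu hu) hv,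
      pow_nonneg hu 3, pow_nonneg hu 4, mul_nonneg (pow_nonneg hu 3) hv,
      mul_nonneg (pow_nonneg hu 4) hv, mul_nonneg (pow_nonneg hu 5) hv, pow_nonneg hu 6]

lemma goliathPoly_le_near_one {x : ℝ} (h₁ : 895/1000 ≤ x) (h₂ : x ≤ 1) :
    12 + 4 * x + 2 * (2 * x * x - 1) + 6 * (8 * x ^ 4 - 8 * x * x + 1) +
        6 * (16 * x ^ 5 - 20 * x ^ 3 + 5 * x) + 6 * (32 * x ^ 6 - 48 * x ^ 4 +
        18 * x * x - 1) ≤ 36 *(1 - 8 * (1 - x)) := by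
  obtain ⟨u, rfl⟩ : ∃ u, x = 1 - u := ⟨1 - x, by ring⟩
  have hu : 0 ≤ u := by linarith
  have hv : 0 ≤ 105/1000 - u := by linarith
  nlinarith [mul_nonneg hu hv, mul_nonneg hu hu, mul_nonneg (mul_nonneg hu hu) hv,
      pow_nonneg hu 3, pow_nonneg hu 4, mul_nonneg (pow_nonneg hu 3) hv,
      mul_nonneg (pow_nonneg hu 4) hv, mul_nonneg (pow_nonneg hu 5) hv, pow_nonneg hu 6]

lemma abs_imQuartic_le {x : ℝ} (h₁ : -1 ≤ x) (h₂ : x ≤ 1) :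
    |32 * x ^ 4 - 32 * x ^ 3 - 32 * x ^ 2 + 28 * x + 10| ≤ 36 := by
  rw [abs_le]
  constructor
  · nlinarith [sq_nonneg (4 * x ^ 2 - 2 * x - 3), sq_nonneg (x), sq_nonneg (x + 1/2),
      sq_nonneg (x ^ 2 - x)]
  · nlinarith [mul_nonneg (sub_nonneg.2 h₂) (by linarith : 0 ≤ x + 1), sq_nonneg x,
      mul_nonneg (mul_nonneg (sub_nonneg.2 h₂) (by linarith : 0 ≤ x + 1)) (sq_nonneg x),
      mul_nonneg (mul_nonneg (sub_nonneg.2 h₂) (by linarith : 0 ≤ x + 1)) (sq_nonneg (x - 1)),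
      sq_nonneg (x + 1)]

lemma goliathPoly_le {x : ℝ} (h₁ : -1 ≤ x) (h₂ : x ≤ 451/500) :
    12 + 4 * x + 2 * (2 * x * x - 1) + 6 * (8 * x ^ 4 - 8 * x * x + 1) +
        6 * (16 * x ^ 5 - 20 * x ^ 3 + 5 * x) + 6 * (32 * x ^ 6 - 48 * x ^ 4 +
        18 * x * x - 1) ≤ 26 := by
  have key : ∀ a b : ℝ, a ≤ x → x ≤ b → ∀ i j : ℕ, 0 ≤ (x - a) ^ i * (b - x) ^ j :=
    fun a b ha hb i j => mul_nonneg (pow_nonneg (sub_nonneg.2 ha) _) (pow_nonneg (sub_nonneg.2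
        hb) _)
  rcases le_total x (-1/4) with h | h
  · have := key _ _ h₁ h
    linarith [this 0 6, this 1 5, this 2 4, this 3 3, this 4 2, this 5 1, this 6 0]
  rcases le_total x (1/2) with h' | h'
  · have := key _ _ h h'
    linarith [this 0 6, this 1 5, this 2 4, this 3 3, this 4 2, this 5 1, this 6 0]
  · have := key _ _ h' h₂
    linarith [this 0 6, this 1 5, this 2 4, this 3 3, this 4 2, this 5 1, this 6 0]

open Real

/-- A cosine polynomial equal to `sin (n t) * cot (t / 2)`. -/
noncomputable def cotKernel (n : ℕ) (t : ℝ) : ℝ :=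
  ∑ j ∈ Finset.range n, (cos (j * t) + cos ((j + 1) * t))

/-- The odd extension of `cotKernel` to integer frequencies. -/
noncomputable def signKernel (n : ℤ) (t : ℝ) : ℝ :=
  n.sign * cotKernel n.natAbs t

lemma continuous_signKernel (n : ℤ) : Continuous (signKernel n) := by
  unfold signKernel cotKernel
  fun_prop

lemma cotKernel_mul (n : ℕ) (t : ℝ) :
    cotKernel n t * (1 - cos t) = sin t * sin (n * t) := by
  induction n with
  | zero => simp [cotKernel]
  | succ n ih =>
    rw [cotKernel, Finset.sum_range_succ, ← cotKernel, add_mul, ih]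
    push_cast
    rw [add_mul (n : ℝ), one_mul, cos_add, sin_add]
    linear_combination -cos (n * t) * sin_sq_add_cos_sq t

lemma signKernel_mul (n : ℤ) (t : ℝ) :
    signKernel n t * (1 - cos t) = sin t * sin (n * t) := by
  rw [signKernel, mul_assoc, cotKernel_mul]
  rcases lt_trichotomy n 0 with h | rfl | h
  · have : ((n.natAbs : ℕ) : ℝ) = -n := by
      rw [Nat.cast_natAbs, abs_of_neg h]; simp
    rw [this, Int.sign_eq_neg_one_of_neg h, neg_mul, sin_neg]
    simp
  · simp
  · have : ((n.natAbs : ℕ) : ℝ) = n := by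
      rw [Nat.cast_natAbs, abs_of_pos h]
    rw [this, Int.sign_eq_one_of_pos h]
    simp

lemma integral_cos_nat_mul (j : ℕ) :
    ∫ t in (0 : ℝ)..π, cos (j * t) = if j = 0 then π else 0 := by
  split_ifs with h
  · simp [h]
  · have : (j : ℝ) ≠ 0 := by exact_mod_cast h
    rw [intervalIntegral.integral_comp_mul_left (fun t => cos t) this]
    simp

lemma integral_cotKernel (n : ℕ) :
    ∫ t in (0 : ℝ)..π, cotKernel n t = if n = 0 then 0 else π := by
  induction n with
  | zero => simp [cotKernel]
  | succ n ih =>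
    have h₁ : ∀ n, Continuous (cotKernel n) := fun n => by unfold cotKernel; fun_prop
    have h₂ : cotKernel (n + 1) = fun t =>
        cotKernel n t + (cos (n * t) + cos (((n + 1 : ℕ) : ℝ) * t)) := by
      ext t
      rw [cotKernel, Finset.sum_range_succ, ← cotKernel]
      push_cast
      rfl
    rw [h₂, intervalIntegral.integral_add ((h₁ n).intervalIntegrable _ _)
      (Continuous.intervalIntegrable (by fun_prop) _ _),
      intervalIntegral.integral_add (Continuous.intervalIntegrable (by fun_prop) _ _)
      (Continuous.intervalIntegrable (by fun_prop) _ _), ih, integral_cos_nat_mul,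
      integral_cos_nat_mul]
    rcases n with _ | n <;> simp

lemma integral_signKernel (n : ℤ) :
    ∫ t in (0 : ℝ)..π, signKernel n t = π * n.sign := by
  simp only [signKernel]
  rw [intervalIntegral.integral_const_mul, integral_cotKernel]
  rcases eq_or_ne n 0 with rfl | h
  · simp
  · simp [h, mul_comm]

/-- The integrand whose mean over `[0, π]` counts David's wins minus Goliath's wins. -/
noncomputable def advantage (k : ℕ) (t : ℝ) : ℝ :=
  ∑ p : (Fin k → Fin 6) × (Fin k → Fin 6), signKernel (lead p) t

lemma continuous_advantage (k : ℕ) : Continuous (advantage k) :=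
  continuous_finsetSum _ fun p _ => continuous_signKernel (lead p)

lemma integral_advantage (k : ℕ) :
    ∫ t in (0 : ℝ)..π, advantage k t = π *
      (((Finset.univ.filter fun p : (Fin k → Fin 6) × (Fin k → Fin 6) => 0 < lead p).card : ℝ) -
        (Finset.univ.filter fun p : (Fin k → Fin 6) × (Fin k → Fin 6) => lead p < 0).card) := by
  simp only [advantage]
  rw [intervalIntegral.integral_finsetSum fun p _ =>
    (continuous_signKernel (lead p)).intervalIntegrable _ _]
  simp only [integral_signKernel]
  rw [← Finset.mul_sum]
  congr 1
  rw [Finset.cast_card, Finset.cast_card, Finset.sum_filter, Finset.sum_filter,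
    ← Finset.sum_sub_distrib]
  refine Finset.sum_congr rfl fun p _ => ?_
  rcases lt_trichotomy (lead p) 0 with h | h | h
  · simp [Int.sign_eq_neg_one_of_neg h, h, h.not_gt]
  · simp [h]
  · simp [Int.sign_eq_one_of_pos h, h, h.not_gt]

/-- The characteristic function of one roll of David minus one roll of Goliath. -/
noncomputable def rollChar (t : ℝ) : ℂ :=
  ((∑ a, Complex.exp (t * David a * Complex.I)) *
    ∑ b, Complex.exp (-(t * Goliath b * Complex.I))) / 36

lemma advantage_mul (k : ℕ) (t : ℝ) :
    advantage k t * (1 - cos t) = 36 ^ k * (sin t * (rollChar t ^ k).im) := by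
  have h : ∑ p : (Fin k → Fin 6) × (Fin k → Fin 6), Complex.exp ((lead p * t : ℝ) * Complex.I) =
      ((36 ^ k : ℝ) : ℂ) * rollChar t ^ k := by
    rw [rollChar, div_pow, ← sum_prod_mul_prod]
    push_cast
    rw [mul_div_cancel₀ _ (pow_ne_zero _ (by norm_num))]
    refine Finset.sum_congr rfl fun p _ => ?_
    rw [← Complex.exp_sum, ← Complex.exp_sum, ← Complex.exp_add]
    congr 1
    simp only [lead, sumRolls, Finset.sum_neg_distrib, ← Finset.sum_mul, ← Finset.mul_sum]
    push_cast
    ring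
  have h₁ := congrArg Complex.im h
  rw [Complex.im_sum, Complex.im_ofReal_mul] at h₁
  simp only [Complex.exp_ofReal_mul_I_im] at h₁
  rw [advantage, Finset.sum_mul]
  simp only [signKernel_mul]
  rw [← Finset.mul_sum, h₁]
  ring

lemma exp_mul_I_pow (t : ℝ) :
    Complex.exp (t * Complex.I) = ⟨cos t, sin t⟩ ∧
    Complex.exp (t * Complex.I) ^ 2 = ⟨2 * cos t ^ 2 - 1, sin t * (2 * cos t)⟩ ∧
    Complex.exp (t * Complex.I) ^ 3 = ⟨4 * cos t ^ 3 - 3 * cos t, sin t * (4 * cos t ^ 2 - 1)⟩ ∧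
    Complex.exp (t * Complex.I) ^ 4 =
      ⟨8 * cos t ^ 4 - 8 * cos t ^ 2 + 1, sin t * (8 * cos t ^ 3 - 4 * cos t)⟩ ∧
    Complex.exp (t * Complex.I) ^ 5 = ⟨16 * cos t ^ 5 - 20 * cos t ^ 3 + 5 * cos t,
      sin t * (16 * cos t ^ 4 - 12 * cos t ^ 2 + 1)⟩ ∧
    Complex.exp (t * Complex.I) ^ 6 = ⟨32 * cos t ^ 6 - 48 * cos t ^ 4 + 18 * cos t ^ 2 - 1,
      sin t * (32 * cos t ^ 5 - 32 * cos t ^ 3 + 6 * cos t)⟩ := by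
  have h := sin_sq_add_cos_sq t
  have step : ∀ (n : ℕ) (a b : ℝ), Complex.exp (t * Complex.I) ^ n = ⟨a, sin t * b⟩ →
      Complex.exp (t * Complex.I) ^ (n + 1) =
        ⟨a * cos t - (1 - cos t ^ 2) * b, sin t * (a + b * cos t)⟩ := by
    intro n a b hn
    rw [pow_succ, hn]
    apply Complex.ext
    · rw [Complex.mul_re, Complex.exp_ofReal_mul_I_re, Complex.exp_ofReal_mul_I_im]
      linear_combination -b * h
    · rw [Complex.mul_im, Complex.exp_ofReal_mul_I_re, Complex.exp_ofReal_mul_I_im]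
      ring
  have h₁ : Complex.exp (t * Complex.I) ^ 1 = ⟨cos t, sin t * 1⟩ := by
    rw [pow_one]
    apply Complex.ext
    · simp [Complex.exp_ofReal_mul_I_re]
    · simp [Complex.exp_ofReal_mul_I_im]
  have h₂ := step _ _ _ h₁
  have h₃ := step _ _ _ h₂
  have h₄ := step _ _ _ h₃
  have h₅ := step _ _ _ h₄
  have h₆ := step _ _ _ h₅
  refine ⟨by simpa using h₁, ?_, ?_, ?_, ?_, ?_⟩
  · rw [h₂]; congr 1 <;> ring
  · rw [h₃]; congr 1 <;> ring
  · rw [h₄]; congr 1 <;> ring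
  · rw [h₅]; congr 1 <;> ring
  · rw [h₆]; congr 1 <;> ring

lemma exp_mul_I_inv_pow (t : ℝ) (n : ℕ) :
    (Complex.exp (t * Complex.I))⁻¹ ^ n = starRingEnd ℂ (Complex.exp (t * Complex.I) ^ n) := by
  rw [map_pow, ← Complex.exp_neg, ← Complex.exp_conj]
  simp

lemma sum_exp_goliath (t : ℝ) :
    ∑ b, Complex.exp (-(t * Goliath b * Complex.I)) =
      1 + (Complex.exp (t * Complex.I))⁻¹ ^ 1 + (Complex.exp (t * Complex.I))⁻¹ ^ 2 +
        3 * (Complex.exp (t * Complex.I))⁻¹ ^ 6 := by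
  simp only [← Complex.exp_neg, ← Complex.exp_nat_mul]
  simp [Fin.sum_univ_six, Goliath]
  ring_nf

lemma sum_exp_david (t : ℝ) :
    ∑ a, Complex.exp (t * David a * Complex.I) =
      2 * Complex.exp (t * Complex.I) ^ 1 + 2 * Complex.exp (t * Complex.I) ^ 4 +
        Complex.exp (t * Complex.I) ^ 5 + Complex.exp (t * Complex.I) ^ 6 := by
  simp only [← Complex.exp_nat_mul]
  simp [Fin.sum_univ_six, David]
  ring_nf

lemma rollChar_eq (t : ℝ) :
    rollChar t = ⟨(5 + 7 * cos t + 8 * (2 * cos t * cos t - 1) + 3 * (4 * cos t ^ 3 - 3 * cos t) +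
      4 * (8 * cos t ^ 4 - 8 * cos t * cos t + 1) +
      8 * (16 * cos t ^ 5 - 20 * cos t ^ 3 + 5 * cos t) +
      (32 * cos t ^ 6 - 48 * cos t ^ 4 + 18 * cos t * cos t - 1)) / 36,
      -(sin t * (1 - cos t) *
        (32 * cos t ^ 4 - 32 * cos t ^ 3 - 32 * cos t ^ 2 + 28 * cos t + 10) / 36)⟩ := by
  have h : rollChar t = (5 + 2 * Complex.exp (t * Complex.I) + 2 * Complex.exp (t * Complex.I) ^ 2 +
      3 * Complex.exp (t * Complex.I) ^ 3 + 4 * Complex.exp (t * Complex.I) ^ 4 +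
      2 * Complex.exp (t * Complex.I) ^ 5 + Complex.exp (t * Complex.I) ^ 6 +
      5 * (Complex.exp (t * Complex.I))⁻¹ ^ 1 + 6 * (Complex.exp (t * Complex.I))⁻¹ ^ 2 +
      6 * (Complex.exp (t * Complex.I))⁻¹ ^ 5) / 36 := by
    rw [rollChar, sum_exp_david, sum_exp_goliath]
    have := Complex.exp_ne_zero (t * Complex.I)
    field_simp
    ring
  obtain ⟨h₁, h₂, h₃, h₄, h₅, h₆⟩ := exp_mul_I_pow t
  rw [h]
  simp only [exp_mul_I_inv_pow, h₂, h₃, h₄, h₅, h₆]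
  rw [pow_one, h₁]
  apply Complex.ext
  · simp
    ring
  · simp
    ring

lemma norm_rollChar_sq_le (t : ℝ) :
    36 * ‖rollChar t‖ ^ 2 ≤ 12 + 4 * cos t + 2 * (2 * cos t * cos t - 1) +
      6 * (8 * cos t ^ 4 - 8 * cos t * cos t + 1) +
      6 * (16 * cos t ^ 5 - 20 * cos t ^ 3 + 5 * cos t) +
      6 * (32 * cos t ^ 6 - 48 * cos t ^ 4 + 18 * cos t * cos t - 1) := by
  obtain ⟨h₁, h₂, -, -, -, h₆⟩ := exp_mul_I_pow t
  have hD : ‖∑ a, Complex.exp (t * David a * Complex.I)‖ ≤ 6 := by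
    refine (norm_sum_le _ _).trans ?_
    have : ∀ a, ‖Complex.exp (t * David a * Complex.I)‖ = 1 := fun a => by
      exact_mod_cast Complex.norm_exp_ofReal_mul_I (t * David a)
    simp [this]
  have hG : ‖∑ b, Complex.exp (-(t * Goliath b * Complex.I))‖ ^ 2 = 12 + 4 * cos t +
      2 * (2 * cos t * cos t - 1) + 6 * (8 * cos t ^ 4 - 8 * cos t * cos t + 1) +
      6 * (16 * cos t ^ 5 - 20 * cos t ^ 3 + 5 * cos t) +
      6 * (32 * cos t ^ 6 - 48 * cos t ^ 4 + 18 * cos t * cos t - 1) := by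
    rw [sum_exp_goliath, ← Complex.normSq_eq_norm_sq, Complex.normSq_apply]
    simp only [exp_mul_I_inv_pow, h₂, h₆]
    rw [pow_one, h₁]
    simp
    linear_combination (1 + 2 * cos t + 3 * (32 * cos t ^ 5 - 32 * cos t ^ 3 + 6 * cos t)) ^ 2 *
      sin_sq_add_cos_sq t
  rw [← hG, rollChar, norm_div, norm_mul, div_pow, mul_pow, Complex.norm_ofNat]
  have := pow_le_pow_left₀ (norm_nonneg _) hD 2
  have := mul_le_mul_of_nonneg_right this
    (sq_nonneg ‖∑ b, Complex.exp (-(t * Goliath b * Complex.I))‖)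
  linarith

lemma abs_im_pow_le (z : ℂ) (k : ℕ) : |(z ^ (k + 1)).im| ≤ (k + 1) * (|z.im| * ‖z‖ ^ k) := by
  induction k with
  | zero => simp
  | succ k ih =>
    have h₁ : |(z ^ (k + 1)).re| ≤ ‖z‖ ^ (k + 1) := by
      rw [← norm_pow]; exact Complex.abs_re_le_norm _
    calc |(z ^ (k + 1 + 1)).im| = |(z ^ (k + 1)).re * z.im + (z ^ (k + 1)).im * z.re| := by
          rw [pow_succ, Complex.mul_im]
      _ ≤ |(z ^ (k + 1)).re| * |z.im| + |(z ^ (k + 1)).im| * |z.re| := by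
          rw [← abs_mul, ← abs_mul]; exact abs_add_le _ _
      _ ≤ ‖z‖ ^ (k + 1) * |z.im| + ((k + 1) * (|z.im| * ‖z‖ ^ k)) * ‖z‖ := by
          gcongr
          exact Complex.abs_re_le_norm _
      _ = _ := by push_cast; ring

lemma re_im_one_sub_pow {ε : ℝ} (hε : 0 ≤ ε) (k : ℕ) (hk : k * ε ≤ 1) :
    1 - (k * ε) ^ 2 / 2 ≤ (((⟨1, -ε⟩ : ℂ)) ^ k).re ∧ (((⟨1, -ε⟩ : ℂ)) ^ k).re ≤ 1 ∧
      k * ε / 2 ≤ -(((⟨1, -ε⟩ : ℂ)) ^ k).im ∧ -(((⟨1, -ε⟩ : ℂ)) ^ k).im ≤ k * ε := by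
  induction k with
  | zero => simp
  | succ k ih =>
    push_cast at hk ⊢
    have h0 : 0 ≤ k * ε := by positivity
    obtain ⟨h₁, h₂, h₃, h₄⟩ := ih (by nlinarith)
    have hk1 : k * ε ≤ 1 := by nlinarith
    rw [pow_succ (⟨1, -ε⟩ : ℂ), Complex.mul_re, Complex.mul_im]
    generalize (((⟨1, -ε⟩ : ℂ)) ^ k).re = p at *
    generalize (((⟨1, -ε⟩ : ℂ)) ^ k).im = q at *
    simp only
    refine ⟨?_, ?_, ?_, ?_⟩
    · nlinarith [mul_le_mul_of_nonneg_right h₄ hε, sq_nonneg ε]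
    · nlinarith
    · have : 1 / 2 ≤ p := by nlinarith
      nlinarith
    · nlinarith

lemma le_neg_im_pow {z : ℂ} {k : ℕ} (hre : 0 < z.re) (him : z.im ≤ 0)
    (h : (k + 1) * -z.im ≤ z.re) :
    (k + 1) * (-z.im) * z.re ^ k / 2 ≤ -(z ^ (k + 1)).im := by
  have hε : 0 ≤ -z.im / z.re := div_nonneg (by linarith) hre.le
  have h₁ := (re_im_one_sub_pow hε (k + 1) (by
    push_cast
    rw [← mul_div_assoc, div_le_one hre]; exact h)).2.2.1
  have hz : z = (z.re : ℂ) * ⟨1, -(-z.im / z.re)⟩ := by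
    apply Complex.ext
    · simp
    · simp; field_simp
  have h₂ : (z ^ (k + 1)).im = z.re ^ (k + 1) * ((⟨1, -(-z.im / z.re)⟩ : ℂ) ^ (k + 1)).im := by
    rw [← Complex.im_ofReal_mul, Complex.ofReal_pow, ← mul_pow, ← hz]
  rw [h₂]
  have h₃ := mul_le_mul_of_nonneg_left h₁ (pow_pos hre (k + 1)).le
  push_cast at h₃
  calc _ = z.re ^ (k + 1) * ((k + 1) * (-z.im / z.re) / 2) := by rw [pow_succ]; field_simp
    _ ≤ _ := by linarith

lemma le_one_sub_cos {t : ℝ} (h₀ : 0 ≤ t) (h₁ : t ≤ 9/20) : 489/1000 * t ^ 2 ≤ 1 - cos t := by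
  have h := (abs_le.1 (cos_bound (x := t) (by rw [abs_of_nonneg h₀]; linarith))).2
  rw [abs_of_nonneg h₀] at h
  have : t ^ 4 ≤ (9/20) ^ 2 * t ^ 2 := by
    have := pow_le_pow_left₀ h₀ h₁ 2
    nlinarith [sq_nonneg t]
  nlinarith

lemma norm_rollChar_le_exp {t : ℝ} (h₀ : 0 ≤ t) (h₁ : t ≤ 9/20) :
    ‖rollChar t‖ ≤ exp (-(39/20) * t ^ 2) := by
  have hc := le_one_sub_cos h₀ h₁
  have hc' : 895/1000 ≤ cos t := by
    have := one_sub_sq_div_two_le_cos (x := t)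
    nlinarith
  have h := (norm_rollChar_sq_le t).trans (goliathPoly_le_near_one hc' (cos_le_one t))
  have h₂ : ‖rollChar t‖ ^ 2 ≤ exp (-(39/20) * t ^ 2) ^ 2 := by
    rw [← exp_nat_mul]
    have := add_one_le_exp (((2 : ℕ) : ℝ) * (-(39/20) * t ^ 2))
    push_cast at this ⊢
    nlinarith
  exact le_of_sq_le_sq h₂ (exp_pos _).le

lemma norm_rollChar_le {t : ℝ} (h₀ : 9/20 ≤ t) (h₁ : t ≤ π) : ‖rollChar t‖ ≤ 17/20 := by
  have hc : cos t ≤ 451/500 := by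
    have h₂ := cos_le_cos_of_nonneg_of_le_pi (by norm_num) h₁ h₀
    have h₃ := le_one_sub_cos (t := 9/20) (by norm_num) le_rfl
    norm_num at h₃
    linarith
  have h := (norm_rollChar_sq_le t).trans (goliathPoly_le (neg_one_le_cos t) hc)
  nlinarith [norm_nonneg (rollChar t)]

/-- The advantage of Goliath, normalised by the number of outcomes. -/
noncomputable def deficit (k : ℕ) (t : ℝ) : ℝ := -(advantage k t / 36 ^ k)

lemma deficit_mul (k : ℕ) (t : ℝ) :
    deficit k t * (1 - cos t) = sin t * -(rollChar t ^ k).im := by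
  have := advantage_mul k t
  rw [deficit, neg_mul, div_mul_eq_mul_div, this]
  field_simp

lemma one_sub_cos_pos {t : ℝ} (h₀ : 0 < t) (h₁ : t ≤ π) : 0 < 1 - cos t := by
  have := cos_lt_cos_of_nonneg_of_le_pi le_rfl h₁ h₀
  rw [cos_zero] at this
  linarith

lemma abs_deficit_le {k : ℕ} {t : ℝ} (h₀ : 0 < t) (h₁ : t ≤ π) :
    |deficit (k + 1) t| ≤ (k + 1) * t ^ 2 * ‖rollChar t‖ ^ k := by
  have hu := one_sub_cos_pos h₀ h₁
  have hs : 0 ≤ sin t := sin_nonneg_of_nonneg_of_le_pi h₀.le h₁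
  have hs' : sin t ^ 2 ≤ t ^ 2 := pow_le_pow_left₀ hs (sin_le h₀.le) 2
  have hq := abs_imQuartic_le (neg_one_le_cos t) (cos_le_one t)
  have him : |(rollChar t).im| ≤ sin t * (1 - cos t) := by
    rw [rollChar_eq]
    simp only
    rw [abs_neg, abs_div, abs_mul, abs_of_nonneg (mul_nonneg hs hu.le)]
    norm_num
    nlinarith [mul_le_mul_of_nonneg_left hq (mul_nonneg hs hu.le)]
  refine le_of_mul_le_mul_right ?_ hu
  calc |deficit (k + 1) t| * (1 - cos t) = |deficit (k + 1) t * (1 - cos t)| := by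
        rw [abs_mul, abs_of_pos hu]
    _ = sin t * |(rollChar t ^ (k + 1)).im| := by
        rw [deficit_mul, abs_mul, abs_of_nonneg hs, abs_neg]
    _ ≤ sin t * ((k + 1) * ((sin t * (1 - cos t)) * ‖rollChar t‖ ^ k)) := by
        have := abs_im_pow_le (rollChar t) k
        gcongr
        exact this.trans (by gcongr)
    _ = (k + 1) * sin t ^ 2 * ‖rollChar t‖ ^ k * (1 - cos t) := by ring
    _ ≤ _ := by gcongr

lemma le_deficit {k : ℕ} {t : ℝ} (h₀ : 0 < t) (h₁ : t ≤ 3/10) (h : (k + 1) * t ^ 3 ≤ 3) :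
    0 ≤ deficit (k + 1) t ∧
      (k + 1) / 12 * sin t ^ 2 * (1 - 61/12 * (k + 1) * t ^ 2) ≤ deficit (k + 1) t := by
  have hπ : t ≤ π := by linarith [pi_gt_three]
  have hu := one_sub_cos_pos h₀ hπ
  have hs : 0 ≤ sin t := sin_nonneg_of_nonneg_of_le_pi h₀.le hπ
  have hst := sin_le h₀.le
  have hcos := one_sub_sq_div_two_le_cos (x := t)
  have hc : 955/1000 ≤ cos t := by nlinarith
  have hq := six_le_imQuartic hc (cos_le_one t)
  have hq' := imQuartic_le_twelve hc (cos_le_one t)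
  have hre : 1 - 61/12 * t ^ 2 ≤ (rollChar t).re := by
    rw [rollChar_eq]
    refine le_trans ?_ (le_re_poly hc (cos_le_one t))
    linarith
  have him : -(rollChar t).im = sin t * (1 - cos t) *
      ((32 * cos t ^ 4 - 32 * cos t ^ 3 - 32 * cos t ^ 2 + 28 * cos t + 10) / 36) := by
    rw [rollChar_eq]
    ring
  have hre0 : 1/2 ≤ (rollChar t).re := by nlinarith
  have hsu : 0 ≤ sin t * (1 - cos t) := mul_nonneg hs hu.le
  have him1 : sin t * (1 - cos t) / 6 ≤ -(rollChar t).im := by rw [him]; nlinarith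
  have him2 : -(rollChar t).im ≤ t * (t ^ 2 / 2) * (1/3) := by
    rw [him]
    exact mul_le_mul (mul_le_mul hst (by linarith) hu.le h₀.le) (by linarith) (by linarith)
      (by positivity)
  have key := le_neg_im_pow (z := rollChar t) (k := k) (by linarith) (by linarith [him1, hsu]) (by
    calc (k + 1) * -(rollChar t).im ≤ (k + 1) * (t * (t ^ 2 / 2) * (1/3)) := by gcongr
      _ ≤ 1 / 2 := by linarith
      _ ≤ _ := hre0)
  have key2 : deficit (k + 1) t * (1 - cos t) ≥
      ((k + 1) / 12 * sin t ^ 2 * (rollChar t).re ^ k) * (1 - cos t) := by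
    rw [deficit_mul]
    calc sin t * -(rollChar t ^ (k + 1)).im
        ≥ sin t * ((k + 1) * (sin t * (1 - cos t) / 6) * (rollChar t).re ^ k / 2) := by
          refine mul_le_mul_of_nonneg_left (le_trans ?_ key) hs
          gcongr
      _ = _ := by ring
  have key3 := le_of_mul_le_mul_right key2 hu
  refine ⟨le_trans (by positivity) key3, le_trans ?_ key3⟩
  have hb : 1 - 61/12 * (k + 1) * t ^ 2 ≤ (rollChar t).re ^ k := by
    have h₂ := one_add_mul_le_pow (a := -(61/12 * t ^ 2)) (by nlinarith) k
    have h₃ : (1 + -(61/12 * t ^ 2)) ^ k ≤ (rollChar t).re ^ k :=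
      pow_le_pow_left₀ (by nlinarith) (by linarith) k
    nlinarith [sq_nonneg t]
  gcongr

lemma sq_mul_pow_le {k : ℕ} (hk : 149 ≤ k) : (k + 1 : ℝ) ^ 2 * (17/20) ^ k ≤ 1/100000 := by
  induction k, hk using Nat.le_induction with
  | base => norm_num
  | succ k hk ih =>
    have hk' : (149 : ℝ) ≤ k := by exact_mod_cast hk
    have h₁ : ((k : ℝ) + 1 + 1) ^ 2 * (17/20) ≤ (k + 1) ^ 2 := by nlinarith
    push_cast
    calc ((k : ℝ) + 1 + 1) ^ 2 * (17/20 : ℝ) ^ (k + 1)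
        = (((k : ℝ) + 1 + 1) ^ 2 * (17/20)) * (17/20 : ℝ) ^ k := by ring
      _ ≤ (k + 1) ^ 2 * (17/20 : ℝ) ^ k := by gcongr
      _ ≤ _ := ih

lemma abs_deficit_le_tail {k : ℕ} (hk : 149 ≤ k) {t : ℝ} (h₀ : 0 < t) (h₁ : t ≤ π)
    (h : 9 ≤ (k + 1) * t ^ 2) :
    |deficit (k + 1) t| ≤ 1 / (1000 * (k + 1)) * (1 / t ^ 2) := by
  have hk' : (149 : ℝ) ≤ k := by exact_mod_cast hk
  refine (abs_deficit_le h₀ h₁).trans ?_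
  rw [div_mul_div_comm, one_mul, le_div_iff₀ (by positivity)]
  rcases le_total t (9/20) with ht | ht
  · have hy : ‖rollChar t‖ ^ k ≤ exp (-(19/10 * ((k + 1) * t ^ 2))) := by
      refine (pow_le_pow_left₀ (norm_nonneg _) (norm_rollChar_le_exp h₀.le ht) k).trans ?_
      rw [← exp_nat_mul, exp_le_exp]
      nlinarith [sq_nonneg t]
    have hexp := pow_div_factorial_le_exp (x := 19/10 * ((k + 1) * t ^ 2)) (by positivity) 8
    have hone : exp (-(19/10 * ((k + 1) * t ^ 2))) * exp (19/10 * ((k + 1) * t ^ 2)) = 1 := by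
      rw [← exp_add]; simp
    have hs : (9 : ℝ) ^ 6 ≤ ((k + 1) * t ^ 2) ^ 6 := pow_le_pow_left₀ (by norm_num) h 6
    calc (k + 1) * t ^ 2 * ‖rollChar t‖ ^ k * (1000 * (k + 1) * t ^ 2)
        ≤ (k + 1) * t ^ 2 * exp (-(19/10 * ((k + 1) * t ^ 2))) * (1000 * (k + 1) * t ^ 2) := by
          gcongr
      _ = 1000 * ((k + 1) * t ^ 2) ^ 2 * exp (-(19/10 * ((k + 1) * t ^ 2))) := by ring
      _ ≤ exp (19/10 * ((k + 1) * t ^ 2)) * exp (-(19/10 * ((k + 1) * t ^ 2))) := by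
          gcongr
          refine le_trans ?_ hexp
          generalize (k + 1 : ℝ) * t ^ 2 = s at *
          rw [mul_pow, le_div_iff₀ (by positivity)]
          have : s ^ 8 = s ^ 2 * s ^ 6 := by ring
          rw [this]
          norm_num [Nat.factorial] at hs ⊢
          nlinarith [sq_nonneg s]
      _ = 1 := by rw [mul_comm, hone]
  · have h₂ : ‖rollChar t‖ ^ k ≤ (17/20) ^ k :=
      pow_le_pow_left₀ (norm_nonneg _) (norm_rollChar_le ht h₁) k
    have h₃ : t ^ 4 ≤ 100 := by
      have : t ≤ 3.15 := h₁.trans (pi_lt_d2.le)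
      calc t ^ 4 ≤ 3.15 ^ 4 := by gcongr
        _ ≤ 100 := by norm_num
    have h₄ := sq_mul_pow_le hk
    calc (k + 1) * t ^ 2 * ‖rollChar t‖ ^ k * (1000 * (k + 1) * t ^ 2)
        = 1000 * t ^ 4 * ((k + 1) ^ 2 * ‖rollChar t‖ ^ k) := by ring
      _ ≤ 1000 * 100 * (1/100000) := by
          gcongr
          exact le_trans (by gcongr) h₄
      _ = 1 := by norm_num

lemma continuous_deficit (k : ℕ) : Continuous (deficit k) :=
  ((continuous_advantage k).div_const _).neg

lemma integral_deficit_pos {k : ℕ} (hk : 149 ≤ k) :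
    0 < ∫ t in (0 : ℝ)..π, deficit (k + 1) t := by
  have hk' : (149 : ℝ) ≤ k := by exact_mod_cast hk
  obtain ⟨r, hr⟩ : ∃ r, r = √(k + 1 : ℝ) := ⟨_, rfl⟩
  have hrk : (k + 1 : ℝ) = r ^ 2 := by rw [hr, sq_sqrt (by linarith)]
  have hr12 : 12 ≤ r := by rw [hr]; exact le_sqrt_of_sq_le (by linarith)
  have hr0 : 0 < r := by linarith
  have h3r : 3 / r ≤ 3/10 := by rw [div_le_div_iff₀ hr0 (by norm_num)]; linarith
  have h3π : 3 / r ≤ π := by linarith [pi_gt_three]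
  have h23 : 2/5 / r ≤ 3 / r := by gcongr; norm_num
  have hdef : ∀ a b, IntervalIntegrable (deficit (k + 1)) MeasureTheory.volume a b :=
    fun a b => (continuous_deficit _).intervalIntegrable a b
  have hlow : ∀ t, 0 < t → t ≤ 3 / r → 0 ≤ deficit (k + 1) t ∧
      (k + 1) / 12 * sin t ^ 2 * (1 - 61/12 * (k + 1) * t ^ 2) ≤ deficit (k + 1) t := by
    intro t h₀ ht
    refine le_deficit h₀ (ht.trans h3r) ?_
    calc (k + 1) * t ^ 3 ≤ r ^ 2 * (3 / r) ^ 3 := by rw [hrk]; gcongr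
      _ = 27 / r := by field_simp; norm_num
      _ ≤ 3 := by rw [div_le_iff₀ hr0]; linarith
  have hA : r ^ 2 * (2/25) * ((2/5 / r) ^ 3 / 3) - r ^ 4 * (61/150) * ((2/5 / r) ^ 5 / 5) ≤
      ∫ t in (0 : ℝ)..(2/5 / r), deficit (k + 1) t := by
    have heq : ∫ t in (0 : ℝ)..(2/5 / r), (r ^ 2 * (2/25) * t ^ 2 - r ^ 4 * (61/150) * t ^ 4) =
        r ^ 2 * (2/25) * ((2/5 / r) ^ 3 / 3) - r ^ 4 * (61/150) * ((2/5 / r) ^ 5 / 5) := by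
      rw [intervalIntegral.integral_sub (Continuous.intervalIntegrable (by fun_prop) _ _)
        (Continuous.intervalIntegrable (by fun_prop) _ _),
        intervalIntegral.integral_const_mul, intervalIntegral.integral_const_mul, integral_pow,
        integral_pow]
      norm_num
    rw [← heq]
    refine intervalIntegral.integral_mono_on_of_le_Ioo (by positivity)
      (Continuous.intervalIntegrable (by fun_prop) _ _) (hdef _ _) fun t ht => ?_
    refine le_trans ?_ (hlow t ht.1 (ht.2.le.trans h23)).2
    have ht1 : t ≤ 1/25 := ht.2.le.trans (by rw [div_le_iff₀ hr0]; linarith)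
    have hsin : 49/50 * t ≤ sin t := by
      have := sin_gt_sub_cube ht.1
      have h₀ := ht.1
      nlinarith [mul_nonneg h₀.le (mul_nonneg h₀.le (sub_nonneg.2 ht1)),
        mul_nonneg h₀.le (sub_nonneg.2 ht1)]
    have hsin2 : (49/50 * t) ^ 2 ≤ sin t ^ 2 :=
      pow_le_pow_left₀ (by have := ht.1; positivity) hsin 2
    have hfac : 0 ≤ 1 - 61/12 * r ^ 2 * t ^ 2 := by
      have : t ^ 2 ≤ (2/5 / r) ^ 2 := pow_le_pow_left₀ ht.1.le ht.2.le 2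
      have : r ^ 2 * t ^ 2 ≤ r ^ 2 * (2/5 / r) ^ 2 := by gcongr
      have h₂ : r ^ 2 * (2/5 / r) ^ 2 = 4/25 := by field_simp; norm_num
      linarith
    rw [hrk]
    calc r ^ 2 * (2/25) * t ^ 2 - r ^ 4 * (61/150) * t ^ 4
        = r ^ 2 / 12 * (24/25 * t ^ 2) * (1 - 61/12 * r ^ 2 * t ^ 2) := by ring
      _ ≤ _ := by
          gcongr
          nlinarith [sq_nonneg t]
  have hB : 0 ≤ ∫ t in (2/5 / r)..(3 / r), deficit (k + 1) t :=
    intervalIntegral.integral_nonneg h23 fun t ht =>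
      (hlow t (lt_of_lt_of_le (by positivity) ht.1) ht.2).1
  have hC : -(1 / (1000 * r ^ 2) * (r / 3)) ≤ ∫ t in (3 / r)..π, deficit (k + 1) t := by
    have hpos : ∀ t ∈ Set.uIcc (3 / r) π, t ≠ 0 := fun t ht => by
      rw [Set.uIcc_of_le h3π] at ht
      exact (lt_of_lt_of_le (by positivity) ht.1).ne'
    have hii : IntervalIntegrable (fun t : ℝ => 1 / (1000 * r ^ 2) * (1 / t ^ 2))
        MeasureTheory.volume (3 / r) π :=
      ContinuousOn.intervalIntegrable (continuousOn_const.mul (continuousOn_const.div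
        (continuousOn_id.pow 2) fun t ht => pow_ne_zero 2 (hpos t ht)))
    have heq : ∫ t in (3 / r)..π, 1 / (1000 * r ^ 2) * (1 / t ^ 2) =
        1 / (1000 * r ^ 2) * (r / 3 - 1 / π) := by
      rw [intervalIntegral.integral_const_mul]
      congr 1
      rw [intervalIntegral.integral_eq_sub_of_hasDerivAt (f := fun t => -t⁻¹)]
      · field_simp
        ring
      · intro t ht
        exact (hasDerivAt_inv (hpos t ht)).neg.congr_deriv (by simp)
      · exact ContinuousOn.intervalIntegrable (continuousOn_const.div
          (continuousOn_id.pow 2) fun t ht => pow_ne_zero 2 (hpos t ht))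
    calc -(1 / (1000 * r ^ 2) * (r / 3)) ≤ -(1 / (1000 * r ^ 2) * (r / 3 - 1 / π)) := by
          gcongr
          have := one_div_pos.2 pi_pos
          linarith
      _ = ∫ t in (3 / r)..π, -(1 / (1000 * r ^ 2) * (1 / t ^ 2)) := by
          rw [intervalIntegral.integral_neg, heq]
      _ ≤ _ := by
          refine intervalIntegral.integral_mono_on h3π hii.neg (hdef _ _) fun t ht => ?_
          have ht0 : 0 < t := lt_of_lt_of_le (by positivity) ht.1
          have := abs_deficit_le_tail hk ht0 ht.2 (by
            calc (9 : ℝ) = r ^ 2 * (3 / r) ^ 2 := by field_simp; norm_num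
              _ ≤ r ^ 2 * t ^ 2 := by
                have := ht.1
                gcongr
              _ = _ := by rw [hrk])
          rw [hrk] at this
          exact neg_le_of_abs_le this
  rw [← intervalIntegral.integral_add_adjacent_intervals (hdef 0 (3 / r)) (hdef _ _),
    ← intervalIntegral.integral_add_adjacent_intervals (hdef 0 (2/5 / r)) (hdef _ _)]
  have hD : 0 < r ^ 2 * (2/25) * ((2/5 / r) ^ 3 / 3) - r ^ 4 * (61/150) * ((2/5 / r) ^ 5 / 5) -
      1 / (1000 * r ^ 2) * (r / 3) := by
    have : r ^ 2 * (2/25) * ((2/5 / r) ^ 3 / 3) - r ^ 4 * (61/150) * ((2/5 / r) ^ 5 / 5) -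
      1 / (1000 * r ^ 2) * (r / 3) =
        (2/25 * ((2/5) ^ 3 / 3) - 61/150 * ((2/5) ^ 5 / 5) - 1/3000) / r := by
      field_simp
      norm_num
    rw [this]
    exact div_pos (by norm_num) hr0
  linarith

lemma card_lead_pos_lt {k : ℕ} (hk : 0 < k) (hk₄ : k ≠ 4) :
    (Finset.univ.filter fun p : (Fin k → Fin 6) × (Fin k → Fin 6) => 0 < lead p).card <
      (Finset.univ.filter fun p : (Fin k → Fin 6) × (Fin k → Fin 6) => lead p < 0).card := by
  rcases lt_or_ge k 150 with h | h
  · rw [card_lead_pos hk, card_lead_neg hk]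
    exact small_cases k h hk hk₄
  · obtain ⟨k, rfl⟩ : ∃ m, k = m + 1 := ⟨k - 1, by omega⟩
    have h₁ := integral_deficit_pos (k := k) (by omega)
    simp only [deficit] at h₁
    rw [intervalIntegral.integral_neg, intervalIntegral.integral_div, integral_advantage,
      neg_pos, div_neg_iff] at h₁
    have h₂ : (0 : ℝ) < 36 ^ (k + 1) := by positivity
    have h₃ := (h₁.resolve_left fun h => h₂.not_gt h.2).1
    have h₄ := sub_neg.1 (neg_of_mul_neg_right h₃ pi_pos.le)
    exact_mod_cast h₄

/-- David beats Goliath after `k` rolls if and only if `k = 4`; for every other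
positive `k`, Goliath beats David. -/
theorem david_vs_goliath (k : ℕ) (hk : 0 < k) :
    (Beats David Goliath k ↔ k = 4) ∧ (k ≠ 4 → Beats Goliath David k) := by
  rw [david_beats_iff, goliath_beats_iff]
  refine ⟨⟨fun h => ?_, ?_⟩, card_lead_pos_lt hk⟩
  · by_contra h₄
    exact h.not_gt (card_lead_pos_lt hk h₄)
  · rintro rfl
    rw [card_lead_pos hk, card_lead_neg hk]
    exact four_rolls
end

section
/- Let D be the six-sided die with faces {1,1,4,4,5,6} and G the six-sided die with faces {0,1,2,6,6,6}, and let Δ be the 36-faced difference die whose faces are all values g − d for g a face of G and d a face of D (with multiplicity). Then for every integer n ≥ 58117, P(Δ[n] > 0) > P(Δ[n] < 0); equivalently, G[n] beats D[n] for all n ≥ 58117. -/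
/-- The 36-faced difference die Δ = Goliath − David, whose faces are all
values `g − d` for `g` a face of Goliath and `d` a face of David. -/
def DeltaGD : Fin 6 × Fin 6 → ℤ := fun p => Goliath p.1 - David p.2

/-- The function `t ↦ sin (m * t) * cot (t / 2)`, written as a cosine polynomial. -/
noncomputable def conjKernel (m : ℤ) (t : ℝ) : ℝ :=
  (m.sign : ℝ) * ∑ j ∈ Finset.range m.natAbs, (Real.cos (j * t) + Real.cos ((j + 1 : ℕ) * t))

lemma conjKernel_mul_sin (m : ℤ) (t : ℝ) :
    conjKernel m t * Real.sin (t / 2) = Real.sin (m * t) * Real.cos (t / 2) := by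
  have key : ∀ k : ℕ, (∑ j ∈ Finset.range k, (Real.cos (j * t) + Real.cos ((j + 1 : ℕ) * t)))
      * Real.sin (t / 2) = Real.sin (k * t) * Real.cos (t / 2) := by
    intro k
    induction k with
    | zero => simp
    | succ k ih =>
      rw [Finset.sum_range_succ, add_mul, ih]
      have h : ((k + 1 : ℕ) : ℝ) * t = k * t + 2 * (t / 2) := by push_cast; ring
      rw [h, Real.cos_add, Real.sin_add, Real.sin_two_mul, Real.cos_two_mul]
      linear_combination (-2 * Real.sin (k * t) * Real.cos (t / 2)) *
        Real.cos_sq_add_sin_sq (t / 2)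
  rw [conjKernel, mul_assoc, key, ← mul_assoc]
  congr 1
  rcases lt_trichotomy m 0 with hm | rfl | hm
  · have h : ((m.natAbs : ℕ) : ℝ) = -m := by
      rw [← Int.cast_natCast, show ((m.natAbs : ℕ) : ℤ) = -m by omega, Int.cast_neg]
    rw [Int.sign_eq_neg_one_of_neg hm, h, neg_mul, Real.sin_neg]
    simp
  · simp
  · have h : ((m.natAbs : ℕ) : ℝ) = m := by
      rw [← Int.cast_natCast, show ((m.natAbs : ℕ) : ℤ) = m by omega]
    rw [Int.sign_eq_one_of_pos hm, h]
    simp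

lemma continuous_conjKernel (m : ℤ) : Continuous (conjKernel m) := by
  unfold conjKernel
  fun_prop

lemma integral_cos_nat_mul_s2 {k : ℕ} (hk : k ≠ 0) :
    ∫ t in (0 : ℝ)..Real.pi, Real.cos (k * t) = 0 := by
  rw [intervalIntegral.integral_comp_mul_left (fun t => Real.cos t) (by exact_mod_cast hk)]
  simp

lemma integral_conjKernel (m : ℤ) :
    ∫ t in (0 : ℝ)..Real.pi, conjKernel m t = Real.pi * (m.sign : ℝ) := by
  have hcosInt : ∀ k : ℕ, IntervalIntegrable (fun t : ℝ => Real.cos (k * t))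
      MeasureTheory.volume 0 Real.pi :=
    fun k => (by fun_prop : Continuous fun t : ℝ => Real.cos (k * t)).intervalIntegrable _ _
  unfold conjKernel
  rw [intervalIntegral.integral_const_mul, intervalIntegral.integral_finsetSum
    fun j _ => (hcosInt j).add (hcosInt (j + 1))]
  have h : ∀ j : ℕ, ∫ t in (0 : ℝ)..Real.pi, (Real.cos (j * t) + Real.cos ((j + 1 : ℕ) * t)) =
      if j = 0 then Real.pi else 0 := by
    intro j
    rw [intervalIntegral.integral_add (hcosInt j) (hcosInt (j + 1)),
      integral_cos_nat_mul_s2 (Nat.succ_ne_zero j)]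
    split_ifs with hj
    · simp [hj]
    · rw [integral_cos_nat_mul_s2 hj, add_zero]
  simp_rw [h]
  rcases eq_or_ne m 0 with rfl | hm
  · simp
  · rw [Finset.sum_ite_eq' (Finset.range m.natAbs) 0, if_pos (by simpa using hm)]
    ring

/-- The characteristic function of one roll of the difference die. -/
noncomputable def charDelta (t : ℝ) : ℂ :=
  (∑ p, Complex.exp ((DeltaGD p * t : ℝ) * Complex.I)) / 36

lemma charDelta_re (t : ℝ) :
    (charDelta t).re = (∑ p, Real.cos (DeltaGD p * t)) / 36 := by
  rw [charDelta, show (36 : ℂ) = ((36 : ℝ) : ℂ) by simp, Complex.div_ofReal_re, Complex.re_sum]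
  simp only [Complex.exp_ofReal_mul_I_re]

lemma charDelta_im (t : ℝ) :
    (charDelta t).im = (∑ p, Real.sin (DeltaGD p * t)) / 36 := by
  rw [charDelta, show (36 : ℂ) = ((36 : ℝ) : ℂ) by simp, Complex.div_ofReal_im, Complex.im_sum]
  simp only [Complex.exp_ofReal_mul_I_im]

lemma charDelta_pow_im (n : ℕ) (t : ℝ) : (charDelta t ^ n).im =
    (∑ f : Fin n → Fin 6 × Fin 6, Real.sin (sumRolls DeltaGD f * t)) / 36 ^ n := by
  rw [charDelta, div_pow, Fintype.sum_pow, show (36 : ℂ) ^ n = ((36 ^ n : ℝ) : ℂ) by simp,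
    Complex.div_ofReal_im, Complex.im_sum]
  congr 1
  refine Finset.sum_congr rfl fun f _ => ?_
  rw [← Complex.exp_sum, ← Finset.sum_mul, ← Complex.ofReal_sum, Complex.exp_ofReal_mul_I_im,
    sumRolls]
  push_cast
  rw [Finset.sum_mul]

/-- The integrand whose mean over `[0, π]` is `P(Δ[n] > 0) - P(Δ[n] < 0)`. -/
noncomputable def signIntegrand (n : ℕ) (t : ℝ) : ℝ :=
  (∑ f : Fin n → Fin 6 × Fin 6, conjKernel (sumRolls DeltaGD f) t) / 36 ^ n

lemma continuous_signIntegrand (n : ℕ) : Continuous (signIntegrand n) := by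
  unfold signIntegrand
  have := continuous_conjKernel
  fun_prop

lemma signIntegrand_mul_sin (n : ℕ) (t : ℝ) :
    signIntegrand n t * Real.sin (t / 2) = (charDelta t ^ n).im * Real.cos (t / 2) := by
  rw [signIntegrand, charDelta_pow_im, div_mul_eq_mul_div, div_mul_eq_mul_div, Finset.sum_mul,
    Finset.sum_mul]
  simp only [conjKernel_mul_sin]

lemma integral_signIntegrand (n : ℕ) : ∫ t in (0 : ℝ)..Real.pi, signIntegrand n t =
    Real.pi * (∑ f : Fin n → Fin 6 × Fin 6, ((sumRolls DeltaGD f).sign : ℝ)) / 36 ^ n := by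
  unfold signIntegrand
  rw [intervalIntegral.integral_div, intervalIntegral.integral_finsetSum
    fun f _ => (continuous_conjKernel _).intervalIntegrable _ _]
  simp only [integral_conjKernel, Finset.mul_sum]

lemma sum_sign_eq_card_sub_card {Ω : Type*} [Fintype Ω] (S : Ω → ℤ) :
    ∑ ω, (S ω).sign = ((Finset.univ.filter fun ω => 0 < S ω).card : ℤ) -
      ((Finset.univ.filter fun ω => S ω < 0).card : ℤ) := by
  rw [Finset.card_filter, Finset.card_filter]
  push_cast
  rw [← Finset.sum_sub_distrib]
  refine Finset.sum_congr rfl fun ω _ => ?_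
  rcases lt_trichotomy (S ω) 0 with h | h | h
  · simp [Int.sign_eq_neg_one_of_neg h, h, h.not_gt]
  · simp [h]
  · simp [Int.sign_eq_one_of_pos h, h, h.not_gt]

lemma prob_pos_gt_prob_neg {Ω : Type*} [Fintype Ω] [Nonempty Ω] (S : Ω → ℤ)
    (h : 0 < ∑ ω, (S ω).sign) :
    prob (fun ω => 0 < S ω) > prob (fun ω => S ω < 0) := by
  unfold prob
  rw [sum_sign_eq_card_sub_card, sub_pos] at h
  apply div_lt_div_of_pos_right _ (by exact_mod_cast Fintype.card_pos)
  convert (Int.cast_lt (R := ℚ)).mpr h using 1 <;> simp <;> congr!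

lemma prob_comp_equiv {Ω Ω' : Type*} [Fintype Ω] [Fintype Ω'] (e : Ω ≃ Ω') (p : Ω' → Prop) :
    prob (fun ω => p (e ω)) = prob p := by
  classical
  unfold prob
  rw [Fintype.card_congr e]
  congr 2
  exact Finset.card_equiv e (by simp)

lemma sumRolls_DeltaGD {n : ℕ} (f : Fin n → Fin 6 × Fin 6) :
    sumRolls DeltaGD f =
      sumRolls Goliath (fun i => (f i).1) - sumRolls David (fun i => (f i).2) := by
  simp only [sumRolls, DeltaGD, Finset.sum_sub_distrib]

lemma beats_iff_prob_DeltaGD (n : ℕ) : Beats Goliath David n ↔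
    prob (fun f : Fin n → Fin 6 × Fin 6 => 0 < sumRolls DeltaGD f) >
      prob (fun f : Fin n → Fin 6 × Fin 6 => sumRolls DeltaGD f < 0) := by
  unfold Beats
  rw [← prob_comp_equiv (Equiv.arrowProdEquivProdArrow (Fin n) (fun _ => Fin 6) (fun _ => Fin 6)),
    ← prob_comp_equiv (Equiv.arrowProdEquivProdArrow (Fin n) (fun _ => Fin 6) (fun _ => Fin 6))]
  simp only [sumRolls_DeltaGD, sub_pos, sub_neg]
  rfl

lemma charDelta_re_lower (t : ℝ) : 1 - 61 / 12 * t ^ 2 ≤ (charDelta t).re := by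
  have h : ∑ p, (1 - (DeltaGD p * t) ^ 2 / 2) ≤ ∑ p, Real.cos (DeltaGD p * t) :=
    Finset.sum_le_sum fun p _ => Real.one_sub_sq_div_two_le_cos
  have e : ∑ p, (1 - (DeltaGD p * t) ^ 2 / 2) = 36 - 183 * t ^ 2 := by
    simp only [Fintype.sum_prod_type, Fin.sum_univ_six, DeltaGD, Goliath, David]
    simp
    ring
  rw [charDelta_re]
  linarith

lemma charDelta_im_eq (t : ℝ) : (charDelta t).im =
    Real.sin t * (1 - Real.cos t) * (32 * Real.cos t ^ 4 - 32 * Real.cos t ^ 3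
      - 32 * Real.cos t ^ 2 + 28 * Real.cos t + 10) / 36 := by
  have h2 : Real.sin (2 * t) = _ := Real.sin_two_mul t
  have h2' : Real.cos (2 * t) = _ := Real.cos_two_mul t
  have h3 : Real.sin (3 * t) = Real.sin t * (4 * Real.cos t ^ 2 - 1) := by
    rw [show 3 * t = 2 * t + t by ring, Real.sin_add, h2, h2']; ring
  have h3' : Real.cos (3 * t) = _ := Real.cos_three_mul t
  have h4 : Real.sin (4 * t) = Real.sin t * (8 * Real.cos t ^ 3 - 4 * Real.cos t) := by
    rw [show 4 * t = 3 * t + t by ring, Real.sin_add, h3, h3']; ring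
  have h5 : Real.sin (5 * t) = Real.sin t * (16 * Real.cos t ^ 4 - 12 * Real.cos t ^ 2 + 1) := by
    rw [show 5 * t = 3 * t + 2 * t by ring, Real.sin_add, h3, h3', h2, h2']; ring
  have h6 : Real.sin (6 * t) =
      Real.sin t * (32 * Real.cos t ^ 5 - 32 * Real.cos t ^ 3 + 6 * Real.cos t) := by
    rw [show 6 * t = 2 * (3 * t) by ring, Real.sin_two_mul, h3, h3']; ring
  have e : ∑ p, Real.sin (DeltaGD p * t) = 3 * Real.sin t + 4 * Real.sin (2 * t)
      - 3 * Real.sin (3 * t) - 4 * Real.sin (4 * t) + 4 * Real.sin (5 * t) - Real.sin (6 * t) := by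
    simp only [Fintype.sum_prod_type, Fin.sum_univ_six, DeltaGD, Goliath, David]
    simp
    ring
  rw [charDelta_im, e, h2, h3, h4, h5, h6]
  ring

lemma charDelta_im_bounds {t : ℝ} (h0 : 0 < t) (h1 : t ≤ 1 / 32) :
    t ^ 3 / 31 ≤ (charDelta t).im ∧ (charDelta t).im ≤ t ^ 3 / 10 := by
  have hs := Real.sin_gt_sub_cube h0
  have hs' := Real.sin_lt h0
  have hc : 1 - t ^ 2 / 2 ≤ Real.cos t := Real.one_sub_sq_div_two_le_cos
  have hc1 := Real.cos_le_one t
  have hpi := Real.pi_gt_three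
  have hpi' := Real.pi_lt_d2
  have hcu : Real.cos t ≤ 1 - t ^ 2 / 5 := by
    have := Real.cos_le_one_sub_mul_cos_sq (x := t) (by rw [abs_of_pos h0]; linarith)
    have h5 : 1 / 5 ≤ 2 / Real.pi ^ 2 := by
      rw [div_le_div_iff₀ (by norm_num) (by positivity)]
      nlinarith
    nlinarith [sq_nonneg t]
  have hcl : 1999 / 2000 ≤ Real.cos t := by nlinarith
  rw [charDelta_im_eq]
  set c := Real.cos t
  set s := Real.sin t
  set R := 32 * c ^ 4 - 32 * c ^ 3 - 32 * c ^ 2 + 28 * c + 10 with hR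
  have hRe : R = 6 + (1 - c) * (4 + 32 * (c * (1 - c ^ 2))) := by rw [hR]; ring
  have hcc : c * (1 - c ^ 2) ≤ 1 := by nlinarith
  have hcc' : 0 ≤ c * (1 - c ^ 2) := mul_nonneg (by linarith) (by nlinarith)
  have hR0 : 6 ≤ R := by
    rw [hRe]
    have := mul_nonneg (sub_nonneg.mpr hc1) (by linarith : 0 ≤ 4 + 32 * (c * (1 - c ^ 2)))
    linarith
  have hR1 : R ≤ 7 := by
    rw [hRe]
    nlinarith
  have hs0 : 99 / 100 * t ≤ s := by nlinarith [mul_pos h0 h0]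
  have ht2 : 0 ≤ t ^ 2 := by positivity
  constructor
  · have a1 : 99 / 100 * t * (t ^ 2 / 5) ≤ s * (1 - c) :=
      mul_le_mul hs0 (by linarith) (by positivity) (by linarith)
    have a2 : 99 / 100 * t * (t ^ 2 / 5) * 6 ≤ s * (1 - c) * R :=
      mul_le_mul a1 hR0 (by norm_num) (le_trans (by positivity) a1)
    have : 0 < t ^ 3 := by positivity
    nlinarith
  · have a1 : s * (1 - c) ≤ t * (t ^ 2 / 2) :=
      mul_le_mul hs'.le (by linarith) (by linarith) h0.le
    have a2 : s * (1 - c) * R ≤ t * (t ^ 2 / 2) * 7 :=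
      mul_le_mul a1 hR1 (by linarith) (by positivity)
    have : 0 < t ^ 3 := by positivity
    nlinarith

lemma norm_charDelta_sq_le (t : ℝ) : ‖charDelta t‖ ^ 2 ≤
    1 - (2 * (1 - Real.cos t) + (1 - Real.cos (2 * t)) + 3 * (1 - Real.cos (4 * t))
      + 3 * (1 - Real.cos (5 * t)) + 3 * (1 - Real.cos (6 * t))) / 18 := by
  set A : ℂ := ∑ g, Complex.exp ((Goliath g * t : ℝ) * Complex.I) with hA
  set B : ℂ := ∑ d, Complex.exp ((-(David d * t) : ℝ) * Complex.I) with hB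
  have hAB : charDelta t = A * B / 36 := by
    rw [charDelta, hA, hB, Fintype.sum_mul_sum, Fintype.sum_prod_type]
    congr 1
    refine Finset.sum_congr rfl fun g _ => Finset.sum_congr rfl fun d _ => ?_
    rw [← Complex.exp_add, DeltaGD]
    congr 1
    push_cast
    ring
  have hBn : ‖B‖ ≤ 6 := by
    refine (norm_sum_le _ _).trans ?_
    simp only [Complex.norm_exp_ofReal_mul_I]
    simp
  have hre : A.re = 1 + Real.cos t + Real.cos (2 * t) + 3 * Real.cos (6 * t) := by
    rw [hA, Complex.re_sum]
    simp only [Complex.exp_ofReal_mul_I_re, Fin.sum_univ_six, Goliath]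
    simp
    ring
  have him : A.im = Real.sin t + Real.sin (2 * t) + 3 * Real.sin (6 * t) := by
    rw [hA, Complex.im_sum]
    simp only [Complex.exp_ofReal_mul_I_im, Fin.sum_univ_six, Goliath]
    simp
    ring
  have hAn : ‖A‖ ^ 2 = 12 + 4 * Real.cos t + 2 * Real.cos (2 * t) + 6 * Real.cos (4 * t)
      + 6 * Real.cos (5 * t) + 6 * Real.cos (6 * t) := by
    have d1 := Real.cos_sub (2 * t) t
    have d2 := Real.cos_sub (6 * t) (2 * t)
    have d3 := Real.cos_sub (6 * t) t
    rw [show 2 * t - t = t by ring] at d1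
    rw [show 6 * t - 2 * t = 4 * t by ring] at d2
    rw [show 6 * t - t = 5 * t by ring] at d3
    rw [← Complex.normSq_eq_norm_sq, Complex.normSq_apply, hre, him]
    linear_combination Real.sin_sq_add_cos_sq t + Real.sin_sq_add_cos_sq (2 * t)
      + 9 * Real.sin_sq_add_cos_sq (6 * t) - 2 * d1 - 6 * d2 - 6 * d3
  have hle : ‖charDelta t‖ ^ 2 ≤ ‖A‖ ^ 2 / 36 := by
    rw [hAB, norm_div, norm_mul, div_pow, mul_pow]
    have : ‖B‖ ^ 2 ≤ 36 := by nlinarith [norm_nonneg B]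
    norm_num
    nlinarith [sq_nonneg ‖A‖]
  rw [hAn] at hle
  linarith

lemma norm_charDelta_le_one (t : ℝ) : ‖charDelta t‖ ≤ 1 := by
  have h := norm_charDelta_sq_le t
  have := Real.cos_le_one
  have : ‖charDelta t‖ ^ 2 ≤ 1 := by
    linarith [this t, this (2 * t), this (4 * t), this (5 * t), this (6 * t)]
  nlinarith [norm_nonneg (charDelta t)]

lemma norm_charDelta_le_exp {δ t : ℝ} (hδ : 0 ≤ δ) (hδ' : δ ≤ 1 / 32) (h : δ ≤ t)
    (ht : t ≤ Real.pi) : ‖charDelta t‖ ≤ Real.exp (-δ ^ 2) := by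
  have hpi := Real.pi_gt_three
  have hpi' := Real.pi_lt_d2
  have hsq := norm_charDelta_sq_le t
  have hcos := Real.cos_le_one
  have hp2 : Real.pi ^ 2 ≤ 10 := by nlinarith
  have h5 : 1 / 5 ≤ 2 / Real.pi ^ 2 := by
    rw [div_le_div_iff₀ (by norm_num) (by positivity)]
    linarith
  have hd2 : δ ^ 2 ≤ t ^ 2 := by gcongr
  have key : ‖charDelta t‖ ^ 2 ≤ 1 - 2 * δ ^ 2 := by
    rcases le_total t (Real.pi / 6) with h6 | h6
    · have c4 := Real.cos_le_one_sub_mul_cos_sq (x := 4 * t) (by rw [abs_of_nonneg] <;> linarith)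
      have c5 := Real.cos_le_one_sub_mul_cos_sq (x := 5 * t) (by rw [abs_of_nonneg] <;> linarith)
      have c6 := Real.cos_le_one_sub_mul_cos_sq (x := 6 * t) (by rw [abs_of_nonneg] <;> linarith)
      have := mul_le_mul_of_nonneg_right h5 (sq_nonneg t)
      linarith [hcos t, hcos (2 * t), sq_nonneg t]
    · have c1 := Real.cos_le_one_sub_mul_cos_sq (x := t) (by rw [abs_of_nonneg] <;> linarith)
      have : 1 / 18 ≤ 2 / Real.pi ^ 2 * t ^ 2 := by
        rw [div_mul_eq_mul_div, div_le_div_iff₀ (by norm_num) (by positivity)]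
        nlinarith
      have : δ ^ 2 ≤ (1 / 32) ^ 2 := by gcongr
      linarith [hcos (2 * t), hcos (4 * t), hcos (5 * t), hcos (6 * t)]
  have hexp : 1 - 2 * δ ^ 2 ≤ Real.exp (-δ ^ 2) ^ 2 := by
    rw [← Real.exp_nat_mul]
    have := Real.add_one_le_exp ((2 : ℕ) * -δ ^ 2)
    push_cast at this ⊢
    linarith
  exact le_of_sq_le_sq (key.trans hexp) (Real.exp_pos _).le

lemma im_pow_lower {z : ℂ} (n : ℕ) (hre : 0 < z.re) (him : 0 ≤ z.im) (hz : ‖z‖ ≤ 1)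
    (hn : n * (z.im / z.re) ≤ 1) : ‖z‖ ^ n * (n * z.im / 2) ≤ (z ^ n).im := by
  have hpi := Real.pi_gt_three
  have hpi' := Real.pi_le_four
  have hz0 : 0 < ‖z‖ := norm_pos_iff.mpr (by rintro rfl; simp at hre)
  have harg0 : 0 ≤ z.arg := Complex.arg_nonneg_iff.mpr him
  have harg1 : z.arg < Real.pi / 2 :=
    (abs_lt.mp (Complex.abs_arg_lt_pi_div_two_iff.mpr (Or.inl hre))).2
  have hupper : n * z.arg ≤ 1 := by
    refine le_trans ?_ hn
    rw [← Complex.tan_arg]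
    gcongr
    exact Real.le_tan harg0 harg1
  have hlower : z.im ≤ z.arg := by
    refine le_trans ?_ (Real.sin_le harg0)
    rw [Complex.sin_arg, le_div_iff₀ hz0]
    nlinarith
  have hpow : (z ^ n).im = ‖z‖ ^ n * Real.sin (n * z.arg) := by
    conv_lhs => rw [← Complex.norm_mul_exp_arg_mul_I z]
    rw [mul_pow, ← Complex.exp_nat_mul, ← mul_assoc, ← Complex.ofReal_natCast,
      ← Complex.ofReal_mul, ← Complex.ofReal_pow, Complex.im_ofReal_mul,
      Complex.exp_ofReal_mul_I_im]
  rw [hpow]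
  gcongr
  have hj := Real.mul_le_sin (by positivity : 0 ≤ n * z.arg) (by linarith)
  have h2 : 1 / 2 ≤ 2 / Real.pi := by
    rw [div_le_div_iff₀ (by norm_num) Real.pi_pos]; linarith
  calc n * z.im / 2 ≤ 1 / 2 * (n * z.arg) := by
        have : (n : ℝ) * z.im ≤ n * z.arg := by gcongr
        linarith
    _ ≤ 2 / Real.pi * (n * z.arg) := by gcongr
    _ ≤ _ := hj

lemma charDelta_pow_im_lower {n : ℕ} {t : ℝ} (h0 : 0 < t) (h1 : t ≤ 1 / 32)
    (hn : n * t ^ 3 ≤ 1) :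
    ‖charDelta t‖ ^ n * (n * t ^ 3 / 62) ≤ (charDelta t ^ n).im := by
  obtain ⟨hl, hu⟩ := charDelta_im_bounds h0 h1
  have hre : 1 / 2 ≤ (charDelta t).re := by
    have := charDelta_re_lower t
    nlinarith
  have him : 0 ≤ (charDelta t).im := le_trans (by positivity) hl
  refine le_trans ?_ (im_pow_lower n (by linarith) him (norm_charDelta_le_one t) ?_)
  · refine mul_le_mul_of_nonneg_left ?_ (by positivity)
    have : (n : ℝ) * (t ^ 3 / 31) ≤ n * (charDelta t).im := by gcongr
    linarith
  · have : (charDelta t).im / (charDelta t).re ≤ t ^ 3 := by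
      rw [div_le_iff₀ (by linarith)]
      have : 0 < t ^ 3 := by positivity
      nlinarith
    exact le_trans (by gcongr) hn

lemma signIntegrand_eq {n : ℕ} {t : ℝ} (h0 : 0 < t) (h1 : t ≤ Real.pi) :
    signIntegrand n t = (charDelta t ^ n).im * Real.cos (t / 2) / Real.sin (t / 2) := by
  have : 0 < Real.sin (t / 2) := Real.sin_pos_of_pos_of_lt_pi (by linarith) (by linarith)
  rw [eq_div_iff this.ne', signIntegrand_mul_sin]

lemma signIntegrand_nonneg {n : ℕ} {t : ℝ} (h0 : 0 < t) (h1 : t ≤ 1 / 32)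
    (hn : n * t ^ 3 ≤ 1) : 0 ≤ signIntegrand n t := by
  have hpi := Real.pi_gt_three
  rw [signIntegrand_eq h0 (by linarith)]
  have him := charDelta_pow_im_lower h0 h1 hn
  have hs : 0 < Real.sin (t / 2) := Real.sin_pos_of_pos_of_lt_pi (by linarith) (by linarith)
  have hc : 0 ≤ Real.cos (t / 2) := Real.cos_nonneg_of_neg_pi_div_two_le_of_le
    (by linarith) (by linarith)
  have : 0 ≤ (charDelta t ^ n).im := le_trans (by positivity) him
  positivity

lemma signIntegrand_lower {n : ℕ} {t : ℝ} (h0 : 0 < t) (h1 : t ≤ 1 / 32)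
    (hn : n * t ^ 3 ≤ 1) (hn' : n * t ^ 2 ≤ 9 / 100) : n * t ^ 2 / 70 ≤ signIntegrand n t := by
  have hpi := Real.pi_gt_three
  rw [signIntegrand_eq h0 (by linarith)]
  have him := charDelta_pow_im_lower h0 h1 hn
  have hs : 0 < Real.sin (t / 2) := Real.sin_pos_of_pos_of_lt_pi (by linarith) (by linarith)
  have hs' : Real.sin (t / 2) ≤ t / 2 := Real.sin_le (by linarith)
  have hc : 1 - (t / 2) ^ 2 / 2 ≤ Real.cos (t / 2) := Real.one_sub_sq_div_two_le_cos
  have hc' : 99 / 100 ≤ Real.cos (t / 2) := by nlinarith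
  have hnorm : 1 / 2 ≤ ‖charDelta t‖ ^ n := by
    have hb : -2 ≤ -(61 / 12 * t ^ 2) := by nlinarith
    have hB := one_add_mul_le_pow hb n
    calc (1 / 2 : ℝ) ≤ 1 + n * -(61 / 12 * t ^ 2) := by linarith
      _ ≤ (1 + -(61 / 12 * t ^ 2)) ^ n := hB
      _ ≤ ‖charDelta t‖ ^ n := by
        gcongr
        · nlinarith
        · have := charDelta_re_lower t
          have := Complex.re_le_norm (charDelta t)
          linarith
  have hnt : 0 ≤ n * t ^ 3 := by positivity
  have him' : n * t ^ 3 / 124 ≤ (charDelta t ^ n).im := by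
    refine le_trans ?_ him
    have := mul_le_mul_of_nonneg_right hnorm (by positivity : 0 ≤ n * t ^ 3 / 62)
    linarith
  rw [le_div_iff₀ hs]
  calc n * t ^ 2 / 70 * Real.sin (t / 2) ≤ n * t ^ 2 / 70 * (t / 2) := by gcongr
    _ = n * t ^ 3 / 140 := by ring
    _ ≤ n * t ^ 3 / 124 * (99 / 100) := by linarith
    _ ≤ _ := mul_le_mul him' hc' (by norm_num) (le_trans (by positivity) him')

lemma signIntegrand_tail {n : ℕ} {δ t : ℝ} (hδ : 0 < δ) (hδ' : δ ≤ 1 / 32) (h : δ ≤ t)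
    (ht : t ≤ Real.pi) : -(Real.pi / δ * Real.exp (-(n * δ ^ 2))) ≤ signIntegrand n t := by
  have hpi := Real.pi_gt_three
  have ht0 : 0 < t := hδ.trans_le h
  have hs : 2 / Real.pi * (t / 2) ≤ Real.sin (t / 2) :=
    Real.mul_le_sin (by linarith) (by linarith)
  have hs' : δ / Real.pi ≤ Real.sin (t / 2) := by
    refine le_trans ?_ hs
    rw [show 2 / Real.pi * (t / 2) = t / Real.pi by ring]
    gcongr
  have hs0 : 0 < δ / Real.pi := by positivity
  have hnorm : ‖charDelta t‖ ^ n ≤ Real.exp (-(n * δ ^ 2)) := by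
    rw [show -(n * δ ^ 2) = n * (-δ ^ 2) by ring, Real.exp_nat_mul]
    gcongr
    exact norm_charDelta_le_exp hδ.le hδ' h ht
  refine neg_le_of_abs_le ?_
  rw [signIntegrand_eq ht0 ht, abs_div, abs_mul, abs_of_pos (hs0.trans_le hs')]
  calc |(charDelta t ^ n).im| * |Real.cos (t / 2)| / Real.sin (t / 2)
      ≤ Real.exp (-(n * δ ^ 2)) * 1 / (δ / Real.pi) := by
        gcongr
        · exact (Complex.abs_im_le_norm _).trans ((norm_pow _ _).trans_le hnorm)
        · exact Real.abs_cos_le_one _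
    _ = _ := by field_simp

lemma exp_dominates {r : ℝ} (hr : 31 / 5 ≤ r) :
    Real.pi * (Real.pi * r ^ 2 * Real.exp (-r ^ 2)) < 9 / (70000 * r ^ 3) := by
  have h0 : 0 < r := by linarith
  have hpi : Real.pi * Real.pi ≤ 10 := by nlinarith [Real.pi_pos, Real.pi_lt_d2]
  have hexp := Real.pow_div_factorial_le_exp (r ^ 2) (by positivity) 12
  have hr19 : (31 / 5 : ℝ) ^ 19 ≤ r ^ 19 := by gcongr
  have hfac : 100000 * r ^ 5 < Real.exp (r ^ 2) := by
    refine lt_of_lt_of_le ?_ hexp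
    rw [lt_div_iff₀ (by positivity)]
    have : ((Nat.factorial 12 : ℕ) : ℝ) = 479001600 := by norm_num [Nat.factorial]
    rw [this]
    have h5 : 0 < r ^ 5 := by positivity
    have : 100000 * 479001600 < r ^ 19 := lt_of_lt_of_le (by norm_num) hr19
    nlinarith
  rw [Real.exp_neg, lt_div_iff₀ (by positivity)]
  have he := Real.exp_pos (r ^ 2)
  have h5 : 0 < r ^ 5 := by positivity
  have : Real.pi * (Real.pi * r ^ 2 * (Real.exp (r ^ 2))⁻¹) * (70000 * r ^ 3) =
      Real.pi * Real.pi * (70000 * r ^ 5) / Real.exp (r ^ 2) := by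
    field_simp
  rw [this, div_lt_iff₀ he]
  nlinarith

lemma integral_signIntegrand_pos {n : ℕ} (hn : 58117 ≤ n) :
    0 < ∫ t in (0 : ℝ)..Real.pi, signIntegrand n t := by
  have hpi := Real.pi_gt_three
  obtain ⟨r, hr0, hrn⟩ : ∃ r : ℝ, 0 ≤ r ∧ r ^ 6 = n :=
    ⟨(n : ℝ) ^ (((6 : ℕ) : ℝ)⁻¹), by positivity,
      Real.rpow_inv_natCast_pow (by positivity) (by norm_num)⟩
  have hr : 31 / 5 ≤ r := by
    refine le_of_pow_le_pow_left₀ (n := 6) (by norm_num) hr0 ?_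
    rw [hrn]
    have : (58117 : ℝ) ≤ n := by exact_mod_cast hn
    refine le_trans (by norm_num) this
  have hrpos : 0 < r := by linarith
  set δ : ℝ := 1 / r ^ 2 with hδ
  set η : ℝ := 3 / (10 * r ^ 3) with hη
  have hη0 : 0 < η := by positivity
  have hδ0 : 0 < δ := by positivity
  have hδ1 : δ ≤ 1 / 32 := by
    rw [hδ]
    gcongr
    nlinarith
  have hηδ : η ≤ δ := by
    rw [hη, hδ, div_le_div_iff₀ (by positivity) (by positivity)]
    have : 0 < r ^ 2 := by positivity
    nlinarith
  have hδ3 : n * δ ^ 3 = 1 := by rw [← hrn, hδ]; field_simp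
  have hδ2 : n * δ ^ 2 = r ^ 2 := by rw [← hrn, hδ]; field_simp
  have hη2 : n * η ^ 2 = 9 / 100 := by rw [← hrn, hη]; field_simp; norm_num
  have hcube : ∀ t : ℝ, 0 ≤ t → t ≤ δ → n * t ^ 3 ≤ 1 := fun t h0 h1 => by
    rw [← hδ3]; gcongr
  have hI : ∀ a b : ℝ, IntervalIntegrable (signIntegrand n) MeasureTheory.volume a b :=
    fun a b => (continuous_signIntegrand n).intervalIntegrable a b
  have i1 : 9 / (70000 * r ^ 3) ≤ ∫ t in (0 : ℝ)..η, signIntegrand n t := by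
    have hg : Continuous fun t : ℝ => n * t ^ 2 / 70 := by fun_prop
    refine le_trans (le_of_eq ?_) (intervalIntegral.integral_mono_on_of_le_Ioo hη0.le
      (hg.intervalIntegrable _ _) (hI _ _) fun t ht => signIntegrand_lower ht.1
        (by linarith [ht.2]) (hcube t ht.1.le (by linarith [ht.2])) ?_)
    · rw [intervalIntegral.integral_div, intervalIntegral.integral_const_mul, integral_pow, ← hrn,
        hη, div_pow, mul_pow]
      field_simp
      ring
    · rw [← hη2]
      have := ht.1.le
      have := ht.2.le
      gcongr
  have i2 : 0 ≤ ∫ t in η..δ, signIntegrand n t :=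
    intervalIntegral.integral_nonneg hηδ fun t ht => signIntegrand_nonneg (hη0.trans_le ht.1)
      (ht.2.trans hδ1) (hcube t (hη0.le.trans ht.1) ht.2)
  have i3 : -(Real.pi * (Real.pi * r ^ 2 * Real.exp (-r ^ 2))) ≤
      ∫ t in δ..Real.pi, signIntegrand n t := by
    have := intervalIntegral.integral_mono_on (by linarith : δ ≤ Real.pi)
      (continuous_const.intervalIntegrable _ _) (hI δ Real.pi)
      fun t ht => signIntegrand_tail (n := n) hδ0 hδ1 ht.1 ht.2
    refine le_trans ?_ this
    rw [intervalIntegral.integral_const, smul_eq_mul, hδ2, mul_neg, neg_le_neg_iff,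
      show Real.pi / δ = Real.pi * r ^ 2 by rw [hδ]; field_simp]
    gcongr
    linarith
  have hfin := exp_dominates hr
  rw [← intervalIntegral.integral_add_adjacent_intervals (hI 0 η) (hI η Real.pi),
    ← intervalIntegral.integral_add_adjacent_intervals (hI η δ) (hI δ Real.pi)]
  linarith

/-- For every `n ≥ 58117`, `P(Δ[n] > 0) > P(Δ[n] < 0)`; equivalently, Goliath
beats David after `n` rolls. -/
theorem goliath_beats_david_eventually (n : ℕ) (hn : 58117 ≤ n) :
    (prob (fun f : Fin n → Fin 6 × Fin 6 => 0 < sumRolls DeltaGD f) >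
      prob (fun f : Fin n → Fin 6 × Fin 6 => sumRolls DeltaGD f < 0)) ∧
    Beats Goliath David n := by
  rw [beats_iff_prob_DeltaGD, and_self]
  apply prob_pos_gt_prob_neg
  have h := integral_signIntegrand_pos hn
  rw [integral_signIntegrand, mul_div_assoc] at h
  have h' := (pos_iff_pos_of_mul_pos h).mp Real.pi_pos
  have h'' := (div_pos_iff_of_pos_right (by positivity : (0 : ℝ) < 36 ^ n)).mp h'
  exact_mod_cast h''
end

section
/- Let D be the three-sided die with faces {−1,−1,2} and let Z be the one-sided die {0}. Then for every positive integer k: if k ≡ 2 (mod 3) then D[k] beats Z[k] (i.e., P(D[k] > 0) > P(D[k] < 0)), and if k ≡ 0 or 1 (mod 3) then Z[k] beats D[k] (i.e., P(D[k] < 0) > P(D[k] > 0)). In particular, the dominance relation between D and Z reverses infinitely many times. -/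
/-- The number of sequences of `k` rolls of the die `{-1, -1, 2}` showing exactly `m` twos. -/
def twoCount (k m : ℕ) : ℤ := (k.choose m : ℤ) * 2 ^ (k - m)

lemma twoCount_nonneg (k m : ℕ) : 0 ≤ twoCount k m := by
  unfold twoCount; positivity

lemma twoCount_pos {k m : ℕ} (h : m ≤ k) : 0 < twoCount k m := by
  have := Nat.choose_pos h
  unfold twoCount; positivity

lemma twoCount_eq_zero {k m : ℕ} (h : k < m) : twoCount k m = 0 := by
  simp [twoCount, Nat.choose_eq_zero_of_lt h]

lemma twoCount_step (k m : ℕ) :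
    2 * ((m : ℤ) + 1) * twoCount k (m + 1) = ((k : ℤ) - m) * twoCount k m := by
  rcases lt_trichotomy m k with h | rfl | h
  · obtain ⟨d, rfl⟩ := Nat.exists_eq_add_of_lt h
    have hc := Nat.choose_succ_right_eq (m + d + 1) m
    rw [show m + d + 1 - m = d + 1 by omega] at hc
    unfold twoCount
    rw [show m + d + 1 - m = d + 1 by omega, show m + d + 1 - (m + 1) = d by omega]
    zify at hc
    push_cast
    linear_combination 2 * 2 ^ d * hc
  · simp [twoCount_eq_zero (Nat.lt_succ_self m)]
  · simp [twoCount_eq_zero h, twoCount_eq_zero (h.trans (Nat.lt_succ_self m))]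

lemma twoCount_pascal (k m : ℕ) :
    twoCount (k + 1) (m + 1) = 2 * twoCount k (m + 1) + twoCount k m := by
  rcases lt_or_ge m k with h | h
  · obtain ⟨d, rfl⟩ := Nat.exists_eq_add_of_lt h
    unfold twoCount
    rw [Nat.choose_succ_succ, show m + d + 1 + 1 - (m + 1) = d + 1 by omega,
      show m + d + 1 - (m + 1) = d by omega, show m + d + 1 - m = d + 1 by omega]
    push_cast
    ring
  · rw [twoCount_eq_zero (Nat.lt_succ_of_le h)]
    simp [twoCount, Nat.choose_succ_succ, Nat.choose_eq_zero_of_lt (Nat.lt_succ_of_le h)]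

lemma sum_twoCount (k : ℕ) : ∑ m ∈ Finset.range (k + 1), twoCount k m = 3 ^ k := by
  have h := add_pow (1 : ℤ) 2 k
  norm_num at h
  rw [h]
  exact Finset.sum_congr rfl fun m _ => by rw [twoCount, mul_comm]

lemma sum_range_twoCount_succ (k n : ℕ) :
    ∑ m ∈ Finset.range (n + 1), twoCount (k + 1) m =
      3 * ∑ m ∈ Finset.range (n + 1), twoCount k m - twoCount k n := by
  induction n with
  | zero =>
    simp only [zero_add, Finset.sum_range_one, twoCount, Nat.choose_zero_right, Nat.sub_zero]
    push_cast
    ring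
  | succ n ih =>
    rw [Finset.sum_range_succ, ih, twoCount_pascal, Finset.sum_range_succ _ (n + 1)]
    ring

/-- The mean of the number of twos in `3 * n` rolls is `n`, in telescoped form. -/
lemma sum_sub_mul_twoCount (n N : ℕ) :
    ∑ m ∈ Finset.range N, 3 * ((n : ℤ) - m) * twoCount (3 * n) m =
      2 * N * twoCount (3 * n) N := by
  induction N with
  | zero => simp
  | succ N ih =>
    have h := twoCount_step (3 * n) N
    rw [Finset.sum_range_succ, ih]
    push_cast at h ⊢
    linear_combination -h

lemma le_of_cross {a b c d x x' y y' : ℤ} (ha : 0 < a) (hc : 0 < c) (hd : 0 ≤ d)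
    (hx : a * x' = b * x) (hy : c * y' = d * y) (h : b * c ≤ a * d) (hx0 : 0 ≤ x)
    (hxy : x ≤ y) : x' ≤ y' := by
  refine le_of_mul_le_mul_left ?_ (mul_pos ha hc)
  calc a * c * x' = b * c * x := by linear_combination c * hx
    _ ≤ a * d * x := by gcongr
    _ ≤ a * d * y := by gcongr
    _ = a * c * y' := by linear_combination -a * hy

lemma lt_of_cross {a b c d x x' y y' : ℤ} (ha : 0 < a) (hc : 0 < c) (hd : 0 < d)
    (hx : a * x' = b * x) (hy : c * y' = d * y) (h : b * c ≤ a * d) (hx0 : 0 ≤ x)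
    (hxy : x < y) : x' < y' := by
  refine lt_of_mul_lt_mul_left ?_ (mul_pos ha hc).le
  calc a * c * x' = b * c * x := by linear_combination c * hx
    _ ≤ a * d * x := by gcongr
    _ < a * d * y := by gcongr
    _ = a * c * y' := by linear_combination -a * hy

lemma twoCount_reflect_le (n j : ℕ) (hj : j ≤ n) :
    twoCount (3 * n + 2) (n - j) ≤ twoCount (3 * n + 2) (n + 1 + j) := by
  induction j with
  | zero =>
    have h := twoCount_step (3 * n + 2) n
    push_cast at h
    have : (2 * ((n : ℤ) + 1)) * (twoCount (3 * n + 2) (n + 1) - twoCount (3 * n + 2) n) = 0 := by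
      linear_combination h
    rcases mul_eq_zero.1 this with h' | h'
    · omega
    · simp only [Nat.sub_zero, Nat.add_zero]
      linarith
  | succ j ih =>
    obtain ⟨i, rfl⟩ := Nat.exists_eq_add_of_le hj
    have h₁ := twoCount_step (3 * (j + 1 + i) + 2) i
    have h₂ := twoCount_step (3 * (j + 1 + i) + 2) (j + 1 + i + 1 + j)
    have ih := ih (by omega)
    rw [show j + 1 + i - j = i + 1 by omega] at ih
    rw [show j + 1 + i - (j + 1) = i by omega]
    rw [add_assoc _ j 1] at h₂
    push_cast at h₁ h₂
    refine le_of_cross (a := 3 * (j + 1 + i) + 2 - i) (b := 2 * (i + 1))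
      (c := 2 * (j + 1 + i + 1 + j + 1)) (d := 3 * (j + 1 + i) + 2 - (j + 1 + i + 1 + j))
      (by omega) (by omega) (by omega) h₁.symm (by linear_combination h₂) ?_
      (twoCount_nonneg _ _) ih
    nlinarith [sq_nonneg ((j : ℤ) + 1)]

lemma sum_twoCount_lt_of_mod_two (n : ℕ) :
    ∑ m ∈ Finset.range (n + 1), twoCount (3 * n + 2) m <
      ∑ m ∈ Finset.Ico (n + 1) (3 * n + 3), twoCount (3 * n + 2) m := by
  rw [← Finset.sum_range_reflect, Finset.sum_Ico_eq_sum_range,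
    show 3 * n + 3 - (n + 1) = n + 1 + (n + 1) by omega,
    Finset.sum_range_add (fun j => twoCount (3 * n + 2) (n + 1 + j))]
  have h₁ : ∑ j ∈ Finset.range (n + 1), twoCount (3 * n + 2) (n + 1 - 1 - j) ≤
      ∑ j ∈ Finset.range (n + 1), twoCount (3 * n + 2) (n + 1 + j) :=
    Finset.sum_le_sum fun j hj => by
      simpa using twoCount_reflect_le n j (by simpa [Nat.lt_succ_iff] using hj)
  have h₂ : 0 < ∑ j ∈ Finset.range (n + 1), twoCount (3 * n + 2) (n + 1 + (n + 1 + j)) :=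
    Finset.sum_pos (fun j hj => twoCount_pos (by have := Finset.mem_range.1 hj; omega)) (by simp)
  linarith

/-- The count at distance `j + 1` below the mean `n` of the number of twos in `3 * n` rolls. -/
def below (n j : ℕ) : ℤ := if j < n then twoCount (3 * n) (n - 1 - j) else 0

/-- The count at distance `j + 1` above the mean `n` of the number of twos in `3 * n` rolls. -/
def above (n j : ℕ) : ℤ := twoCount (3 * n) (n + 1 + j)

lemma below_nonneg (n j : ℕ) : 0 ≤ below n j := by
  unfold below; split_ifs <;> simp [twoCount_nonneg]

lemma above_nonneg (n j : ℕ) : 0 ≤ above n j := twoCount_nonneg _ _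

lemma below_eq_zero {n j : ℕ} (h : n ≤ j) : below n j = 0 := by
  simp [below, h]

lemma below_succ (n j : ℕ) :
    (2 * (n : ℤ) + j + 2) * below n (j + 1) = 2 * (n - j - 1) * below n j := by
  rcases lt_trichotomy n (j + 1) with h | rfl | h
  · rw [below_eq_zero h.le, below_eq_zero (by omega)]; simp
  · rw [below_eq_zero le_rfl]; push_cast; ring
  · obtain ⟨i, rfl⟩ := Nat.exists_eq_add_of_lt h
    have h₁ := twoCount_step (3 * (j + 1 + i + 1)) i
    rw [below, below, if_pos h, if_pos (by omega),
      show j + 1 + i + 1 - 1 - (j + 1) = i by omega, show j + 1 + i + 1 - 1 - j = i + 1 by omega]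
    push_cast at h₁ ⊢
    linear_combination -h₁

lemma above_succ (n j : ℕ) :
    2 * ((n : ℤ) + j + 2) * above n (j + 1) = (2 * n - j - 1) * above n j := by
  have h := twoCount_step (3 * n) (n + 1 + j)
  rw [add_assoc _ j 1] at h
  unfold above
  push_cast at h
  linear_combination h

lemma above_zero_lt_below_zero {n : ℕ} (hn : 0 < n) : above n 0 < below n 0 := by
  obtain ⟨i, rfl⟩ := Nat.exists_eq_add_of_lt hn
  have h₁ := twoCount_step (3 * (0 + i + 1)) i
  have h₂ := twoCount_step (3 * (0 + i + 1)) (i + 1)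
  have h₃ := twoCount_pos (k := 3 * (0 + i + 1)) (m := i) (by omega)
  rw [above, below, if_pos hn]
  simp only [zero_add, Nat.add_sub_cancel, Nat.sub_zero, Nat.add_zero] at *
  push_cast at h₁ h₂
  nlinarith

lemma above_lt_below {n j : ℕ} (hn : 0 < n) (hj : 3 * ((j + 1) * j) < 2 * n) :
    above n j < below n j := by
  induction j with
  | zero => exact above_zero_lt_below_zero hn
  | succ j ih =>
    have hjn : j + 1 < n := by nlinarith
    refine lt_of_cross (a := 2 * ((n : ℤ) + j + 2)) (c := 2 * (n : ℤ) + j + 2)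
      (by omega) (by omega) (by omega) (above_succ n j) (below_succ n j) ?_ (above_nonneg n j)
      (ih (by nlinarith))
    zify at hj
    nlinarith

lemma below_le_above_succ {n j : ℕ} (hn : 0 < n) (h : below n j ≤ above n j) :
    below n (j + 1) ≤ above n (j + 1) := by
  rcases le_or_gt n (j + 1) with hj | hj
  · rw [below_eq_zero hj]; exact above_nonneg _ _
  by_cases hs : 3 * ((j + 2) * (j + 1)) < 2 * n
  · exact absurd (above_lt_below hn (by nlinarith : 3 * ((j + 1) * j) < 2 * n)) h.not_gt
  refine le_of_cross (a := 2 * (n : ℤ) + j + 2) (c := 2 * ((n : ℤ) + j + 2))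
    (by omega) (by omega) (by omega) (below_succ n j) (above_succ n j) ?_ (below_nonneg n j) h
  zify at hs
  nlinarith

lemma sum_mul_below (n : ℕ) (g : ℕ → ℤ) :
    ∑ j ∈ Finset.range (2 * n), g j * below n j =
      ∑ j ∈ Finset.range n, g j * twoCount (3 * n) (n - 1 - j) := by
  rw [two_mul, Finset.sum_range_add (fun j => g j * below n j)]
  simp only [below_eq_zero (Nat.le_add_right n _), mul_zero, Finset.sum_const_zero, add_zero]
  exact Finset.sum_congr rfl fun j hj => by rw [below, if_pos (Finset.mem_range.1 hj)]

lemma sum_succ_mul_below_eq (n : ℕ) :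
    ∑ j ∈ Finset.range (2 * n), ((j : ℤ) + 1) * below n j =
      ∑ j ∈ Finset.range (2 * n), ((j : ℤ) + 1) * above n j := by
  have h := sum_sub_mul_twoCount n (n + 1 + 2 * n)
  rw [twoCount_eq_zero (by omega), mul_zero,
    Finset.sum_range_add (fun m : ℕ => 3 * ((n : ℤ) - m) * twoCount (3 * n) m),
    Finset.sum_range_succ, ← Finset.sum_range_reflect, sub_self] at h
  have h₁ : ∑ j ∈ Finset.range n, 3 * ((n : ℤ) - (n - 1 - j : ℕ)) * twoCount (3 * n) (n - 1 - j) =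
      3 * ∑ j ∈ Finset.range (2 * n), ((j : ℤ) + 1) * below n j := by
    rw [sum_mul_below, Finset.mul_sum]
    refine Finset.sum_congr rfl fun j hj => ?_
    have hj := Finset.mem_range.1 hj
    rw [show ((n : ℤ) - (n - 1 - j : ℕ)) = j + 1 by omega, mul_assoc]
  have h₂ : ∑ j ∈ Finset.range (2 * n),
      3 * ((n : ℤ) - (n + 1 + j : ℕ)) * twoCount (3 * n) (n + 1 + j) =
      -3 * ∑ j ∈ Finset.range (2 * n), ((j : ℤ) + 1) * above n j := by
    rw [Finset.mul_sum]
    refine Finset.sum_congr rfl fun j _ => ?_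
    rw [above]
    push_cast
    ring
  rw [h₁, h₂] at h
  linarith

/-- The difference `below - above` changes sign only once, from positive to negative, and has zero
first moment, so its total is positive. -/
lemma sum_above_lt_sum_below {n : ℕ} (hn : 0 < n) :
    ∑ j ∈ Finset.range (2 * n), above n j < ∑ j ∈ Finset.range (2 * n), below n j := by
  have hex : ∃ j, below n j ≤ above n j := ⟨n, by
    rw [below_eq_zero le_rfl]; exact above_nonneg _ _⟩
  obtain ⟨J, hJ, hmin⟩ : ∃ J, below n J ≤ above n J ∧ ∀ j < J, above n j < below n j :=
    ⟨Nat.find hex, Nat.find_spec hex, fun j hj => not_le.1 (Nat.find_min hex hj)⟩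
  have hge : ∀ j, J ≤ j → below n j ≤ above n j := fun j hj => by
    induction j, hj using Nat.le_induction with
    | base => exact hJ
    | succ j _ ih => exact below_le_above_succ hn ih
  have hJ0 : 0 < J := Nat.pos_of_ne_zero fun h => by
    subst h; exact hJ.not_gt (above_zero_lt_below_zero hn)
  have hpos : 0 < ∑ j ∈ Finset.range (2 * n), ((J : ℤ) - j) * (below n j - above n j) := by
    refine Finset.sum_pos' (fun j _ => ?_) ⟨0, by simp [hn], ?_⟩
    · rcases lt_or_ge j J with h | h
      · exact mul_nonneg (by omega) (by linarith [hmin j h])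
      · exact mul_nonneg_of_nonpos_of_nonpos (by omega) (by linarith [hge j h])
    · exact mul_pos (by omega) (by linarith [above_zero_lt_below_zero hn])
  have heq : ∑ j ∈ Finset.range (2 * n), ((J : ℤ) - j) * (below n j - above n j) =
      ((J : ℤ) + 1) * (∑ j ∈ Finset.range (2 * n), below n j -
        ∑ j ∈ Finset.range (2 * n), above n j) := by
    have h := sum_succ_mul_below_eq n
    have h' : ∀ j : ℕ, ((J : ℤ) - j) * (below n j - above n j) =
        ((J : ℤ) + 1) * (below n j - above n j) - ((j + 1) * below n j - (j + 1) * above n j) :=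
      fun j => by ring
    simp only [h', Finset.sum_sub_distrib, ← Finset.mul_sum]
    linarith
  rw [heq] at hpos
  exact sub_pos.1 (pos_of_mul_pos_right hpos (by positivity))

lemma sum_twoCount_lt_of_mod_zero {n : ℕ} (hn : 0 < n) :
    ∑ m ∈ Finset.Ico (n + 1) (3 * n + 1), twoCount (3 * n) m <
      ∑ m ∈ Finset.range n, twoCount (3 * n) m := by
  rw [← Finset.sum_range_reflect, Finset.sum_Ico_eq_sum_range,
    show 3 * n + 1 - (n + 1) = 2 * n by omega]
  have h := sum_mul_below n 1
  simp only [Pi.one_apply, one_mul] at h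
  rw [← h]
  exact sum_above_lt_sum_below hn

lemma sum_twoCount_lt_of_mod_one (n : ℕ) :
    ∑ m ∈ Finset.Ico (n + 1) (3 * n + 2), twoCount (3 * n + 1) m <
      ∑ m ∈ Finset.range (n + 1), twoCount (3 * n + 1) m := by
  have h : ∑ m ∈ Finset.Ico (n + 1) (3 * n + 1), twoCount (3 * n) m ≤
      ∑ m ∈ Finset.range n, twoCount (3 * n) m := by
    rcases Nat.eq_zero_or_pos n with rfl | hn
    · simp
    · exact (sum_twoCount_lt_of_mod_zero hn).le
  have h₁ := Finset.sum_range_add_sum_Ico (twoCount (3 * n)) (show n + 1 ≤ 3 * n + 1 by omega)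
  have h₂ := Finset.sum_range_add_sum_Ico (twoCount (3 * n + 1))
    (show n + 1 ≤ 3 * n + 2 by omega)
  have h₃ := sum_range_twoCount_succ (3 * n) n
  have h₄ := twoCount_pos (show n ≤ 3 * n by omega)
  have h₅ := Finset.sum_range_succ (twoCount (3 * n)) n
  rw [sum_twoCount] at h₁ h₂
  rw [pow_succ] at h₂
  linarith

/-- The number of twos among `k` rolls of the die `{-1, -1, 2}`. -/
def numTwos {k : ℕ} (f : Fin k → Fin 3) : ℕ := ∑ i, ![0, 0, 1] (f i)

lemma sumRolls_eq {k : ℕ} (f : Fin k → Fin 3) :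
    sumRolls ![-1, -1, 2] f = 3 * (numTwos f : ℤ) - k := by
  have h : ∀ x : Fin 3, (![-1, -1, 2] x : ℤ) = 3 * ((![0, 0, 1] x : ℕ) : ℤ) - 1 := by decide
  simp [sumRolls, numTwos, h, Finset.mul_sum]

lemma numTwos_le {k : ℕ} (f : Fin k → Fin 3) : numTwos f ≤ k := by
  have h : ∀ x : Fin 3, (![0, 0, 1] x : ℕ) ≤ 1 := by decide
  simpa [numTwos] using Finset.sum_le_card_nsmul Finset.univ _ 1 fun i _ => h (f i)

open Polynomial in
lemma card_numTwos_eq (k m : ℕ) :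
    ((Finset.univ.filter fun f : Fin k → Fin 3 => numTwos f = m).card : ℤ) = twoCount k m := by
  have h : (∑ f : Fin k → Fin 3, (X : ℤ[X]) ^ numTwos f) = (X + C 2) ^ k := by
    have h₃ : (X + C 2 : ℤ[X]) = ∑ x : Fin 3, X ^ (![0, 0, 1] x : ℕ) := by
      simp [Fin.sum_univ_three, add_comm, ← one_add_one_eq_two]
    rw [h₃, Fintype.sum_pow]
    exact Finset.sum_congr rfl fun f _ => (Finset.prod_pow_eq_pow_sum _ _ _).symm
  have h' := congrArg (fun q => coeff q m) h
  simp only [finsetSum_coeff, coeff_X_pow, coeff_X_add_C_pow] at h'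
  rw [twoCount, mul_comm, ← h', Finset.card_filter]
  push_cast
  simp only [eq_comm]

lemma card_filter_sumRolls (k : ℕ) (p : ℤ → Prop) [DecidablePred p] :
    ((Finset.univ.filter fun f : Fin k → Fin 3 => p (sumRolls ![-1, -1, 2] f)).card : ℤ) =
      ∑ m ∈ (Finset.range (k + 1)).filter (fun m : ℕ => p (3 * m - k)), twoCount k m := by
  rw [Finset.card_eq_sum_card_fiberwise (f := numTwos)
    (t := (Finset.range (k + 1)).filter (fun m : ℕ => p (3 * m - k)))]
  · push_cast
    refine Finset.sum_congr rfl fun m hm => ?_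
    rw [← card_numTwos_eq, Finset.filter_filter]
    congr 2
    ext f
    have := (Finset.mem_filter.1 hm).2
    simp only [Finset.mem_filter, Finset.mem_univ, true_and, sumRolls_eq]
    exact ⟨And.right, fun h => ⟨h ▸ this, h⟩⟩
  · intro f hf
    simpa [sumRolls_eq, Nat.lt_succ_iff, numTwos_le] using hf

lemma prob_sumRolls_lt (k : ℕ) (p q : ℤ → Prop) (s t : Finset ℕ)
    (hs : ∀ m : ℕ, m ∈ s ↔ m < k + 1 ∧ p (3 * m - k))
    (ht : ∀ m : ℕ, m ∈ t ↔ m < k + 1 ∧ q (3 * m - k))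
    (h : ∑ m ∈ s, twoCount k m < ∑ m ∈ t, twoCount k m) :
    prob (fun f : Fin k → Fin 3 => p (sumRolls ![-1, -1, 2] f)) <
      prob (fun f : Fin k → Fin 3 => q (sumRolls ![-1, -1, 2] f)) := by
  classical
  have hs' : s = (Finset.range (k + 1)).filter (fun m : ℕ => p (3 * m - k)) := by
    ext m; simp [hs]
  have ht' : t = (Finset.range (k + 1)).filter (fun m : ℕ => q (3 * m - k)) := by
    ext m; simp [ht]
  rw [hs', ht', ← card_filter_sumRolls k p, ← card_filter_sumRolls k q] at h
  unfold prob
  gcongr ?_ / _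
  convert (Nat.cast_lt (α := ℚ)).2 (Nat.cast_lt.1 h)

/-- For the die `D = {−1,−1,2}` and the one-sided die `Z = {0}`: if
`k ≡ 2 (mod 3)` then `D[k]` beats `Z[k]` (i.e. `P(D[k] > 0) > P(D[k] < 0)`),
and if `k ≡ 0` or `1 (mod 3)` then `Z[k]` beats `D[k]`
(i.e. `P(D[k] < 0) > P(D[k] > 0)`). -/
theorem periodic_reversal (k : ℕ) (hk : 0 < k) :
    (k % 3 = 2 →
      prob (fun f : Fin k → Fin 3 => 0 < sumRolls ![-1, -1, 2] f) >
        prob (fun f : Fin k → Fin 3 => sumRolls ![-1, -1, 2] f < 0)) ∧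
    (k % 3 = 0 ∨ k % 3 = 1 →
      prob (fun f : Fin k → Fin 3 => sumRolls ![-1, -1, 2] f < 0) >
        prob (fun f : Fin k → Fin 3 => 0 < sumRolls ![-1, -1, 2] f)) := by
  obtain ⟨n, hn⟩ : ∃ n, k / 3 = n := ⟨_, rfl⟩
  refine ⟨fun h => ?_, fun h => ?_⟩
  · obtain rfl : k = 3 * n + 2 := by omega
    exact prob_sumRolls_lt _ (· < 0) (0 < ·) _ _
      (fun m => by rw [Finset.mem_range]; push_cast; omega)
      (fun m => by rw [Finset.mem_Ico]; push_cast; omega) (sum_twoCount_lt_of_mod_two n)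
  · rcases h with h | h
    · obtain rfl : k = 3 * n := by omega
      exact prob_sumRolls_lt _ (0 < ·) (· < 0) _ _
        (fun m => by rw [Finset.mem_Ico]; push_cast; omega)
        (fun m => by rw [Finset.mem_range]; push_cast; omega)
        (sum_twoCount_lt_of_mod_zero (by omega))
    · obtain rfl : k = 3 * n + 1 := by omega
      exact prob_sumRolls_lt _ (0 < ·) (· < 0) _ _
        (fun m => by rw [Finset.mem_Ico]; push_cast; omega)
        (fun m => by rw [Finset.mem_range]; push_cast; omega) (sum_twoCount_lt_of_mod_one n)
end

section
/- Let X be a die with integer faces, mean 0, and at least two distinct face values. Then the tilt of the sum of n independent rolls tends to zero: T(X[n]) = P(X[n] > 0) − P(X[n] < 0) → 0 as n → ∞. -/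
open MeasureTheory ProbabilityTheory Filter Topology

theorem prob_eq_uniformOn_real {Ω : Type*} [Fintype Ω] [MeasurableSpace Ω]
    [MeasurableSingletonClass Ω] (p : Ω → Prop) :
    (prob p : ℝ) = (uniformOn (Set.univ : Set Ω)).real {x | p x} := by
  classical
  have h : {x | p x} = ((Finset.univ.filter p : Finset Ω) : Set Ω) := by simp
  rw [measureReal_def, uniformOn_univ, h, Measure.count_apply_finset]
  simp only [prob, ENNReal.toReal_div, ENNReal.toReal_natCast, Rat.cast_div, Rat.cast_natCast]

theorem infinitePi_map_fin {α : Type*} [MeasurableSpace α] (μ : Measure α)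
    [IsProbabilityMeasure μ] (n : ℕ) :
    (Measure.infinitePi fun _ : ℕ => μ).map (fun ω (i : Fin n) => ω i) =
      Measure.pi fun _ : Fin n => μ := by
  have hindep : iIndepFun (fun (i : ℕ) (ω : ℕ → α) => ω i) (Measure.infinitePi fun _ => μ) :=
    iIndepFun_infinitePi (P := fun _ : ℕ => μ) (X := fun _ => id) fun _ => measurable_id
  have h := (iIndepFun_iff_map_fun_eq_pi_map
    (fun i : Fin n => (measurable_pi_apply (i : ℕ)).aemeasurable)).1
      (hindep.precomp Fin.val_injective)
  simpa [Measure.infinitePi_map_eval (fun _ : ℕ => μ)] using h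

theorem gaussianReal_Iio_zero_eq_Ioi_zero (v : NNReal) :
    gaussianReal 0 v (Set.Iio 0) = gaussianReal 0 v (Set.Ioi 0) := by
  have h := gaussianReal_map_neg (μ := 0) (v := v)
  rw [neg_zero] at h
  conv_rhs => rw [← h]
  rw [Measure.map_apply measurable_neg measurableSet_Ioi]
  congr 1
  ext x
  simp

/-- By the central limit theorem and the symmetry of the Gaussian law, the partial sums of
centered nondegenerate i.i.d. random variables are asymptotically as likely to be positive as
negative. -/
theorem tendsto_measureReal_sum_pos_sub_neg {Ω : Type*} {mΩ : MeasurableSpace Ω}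
    {P : Measure Ω} [IsProbabilityMeasure P] {Y : ℕ → Ω → ℝ} (hY : MemLp (Y 0) 2 P)
    (hmean : P[Y 0] = 0) (hvar : Var[Y 0; P] ≠ 0) (hindep : iIndepFun Y P)
    (hident : ∀ i, IdentDistrib (Y i) (Y 0) P P) :
    Tendsto (fun n : ℕ => P.real {ω | 0 < ∑ k ∈ Finset.range n, Y k ω} -
      P.real {ω | ∑ k ∈ Finset.range n, Y k ω < 0}) atTop (𝓝 0) := by
  set v := Var[Y 0; P].toNNReal with hv
  have hv0 : v ≠ 0 := by
    simpa [hv] using (variance_nonneg (Y 0) P).lt_of_ne' hvar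
  have := nullSingletonClass_gaussianReal (μ := 0) hv0
  have hclt := tendstoInDistribution_inv_sqrt_mul_sum_sub (P' := gaussianReal 0 v) (Y := id)
    ⟨aemeasurable_id, Measure.map_id⟩ hY hindep hident
  have hlim (E : Set ℝ) (hE : MeasurableSet E) (hfr : frontier E = {0}) :
      Tendsto (fun n : ℕ => P.real {ω | (√n)⁻¹ * ∑ k ∈ Finset.range n, Y k ω ∈ E})
        atTop (𝓝 ((gaussianReal 0 v).real E)) := by
    have h := ProbabilityMeasure.tendsto_measure_of_null_frontier_of_tendsto' hclt.tendsto
      (E := E) (by simp [hfr])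
    simp only [Measure.map_id, ProbabilityMeasure.coe_mk] at h
    have h' := (ENNReal.tendsto_toReal (measure_ne_top _ _)).comp h
    refine h'.congr fun n => ?_
    simp only [Function.comp_apply]
    rw [Measure.map_apply_of_aemeasurable (hclt.forall_aemeasurable n) hE]
    simp [hmean, measureReal_def, Set.preimage]
  have hdiff := (hlim (Set.Ioi 0) measurableSet_Ioi frontier_Ioi).sub
    (hlim (Set.Iio 0) measurableSet_Iio frontier_Iio)
  rw [measureReal_def, measureReal_def, gaussianReal_Iio_zero_eq_Ioi_zero, sub_self] at hdiff
  refine hdiff.congr' ?_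
  filter_upwards [eventually_gt_atTop 0] with n hn
  have hs : 0 < (√(n : ℝ))⁻¹ := by positivity
  simp only [Set.mem_Ioi, Set.mem_Iio, mul_pos_iff_of_pos_left hs, mul_neg_iff, hs, hs.not_gt,
    true_and, false_and, or_false]

theorem integral_uniformOn_univ {ι : Type*} [Fintype ι] [MeasurableSpace ι]
    [MeasurableSingletonClass ι] (f : ι → ℝ) :
    ∫ i, f i ∂uniformOn (Set.univ : Set ι) = (∑ i, f i) / Fintype.card ι := by
  rw [uniformOn, ProbabilityTheory.cond, Measure.restrict_univ, integral_smul_measure,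
    integral_count]
  simp [div_eq_inv_mul]

/-- For a die `X` with integer faces, mean `0`, and at least two distinct face
values, the tilt of the sum of `n` rolls,
`T(X[n]) = P(X[n] > 0) − P(X[n] < 0)`, tends to `0` as `n → ∞`. -/
theorem tilt_tendsto_zero (m : ℕ) (hm : 0 < m) (X : Fin m → ℤ)
    (hmean : (∑ i, (X i : ℚ)) / (m : ℚ) = 0)
    (hdistinct : ∃ i j, X i ≠ X j) :
    Filter.Tendsto
      (fun n : ℕ =>
        ((prob (fun f : Fin n → Fin m => 0 < sumRolls X f) : ℝ) -
          (prob (fun f : Fin n → Fin m => sumRolls X f < 0) : ℝ)))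
      Filter.atTop (nhds 0) := by
  have : NeZero m := ⟨hm.ne'⟩
  set μ : Measure (Fin m) := uniformOn Set.univ with hμ
  have : IsProbabilityMeasure μ := isProbabilityMeasure_uniformOn Set.finite_univ Set.univ_nonempty
  set P : Measure (ℕ → Fin m) := Measure.infinitePi fun _ => μ with hP
  set D : Fin m → ℝ := fun i => X i with hD
  have hDm : Measurable D := .of_discrete
  set Y : ℕ → (ℕ → Fin m) → ℝ := fun k ω => D (ω k) with hYdef
  have hYm (k : ℕ) : Measurable (Y k) := hDm.comp (measurable_pi_apply k)
  have hpres (k : ℕ) : MeasurePreserving (fun ω : ℕ → Fin m => ω k) P μ :=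
    measurePreserving_eval_infinitePi (fun _ : ℕ => μ) k
  have hindep : iIndepFun Y P :=
    iIndepFun_infinitePi (P := fun _ : ℕ => μ) (X := fun _ => D) fun _ => hDm
  have hident (k : ℕ) : IdentDistrib (Y k) D P μ := by
    refine IdentDistrib.comp (f := fun ω : ℕ → Fin m => ω k) (g := id) ?_ hDm
    exact ⟨(hpres k).aemeasurable, aemeasurable_id, (hpres k).map_eq.trans Measure.map_id.symm⟩
  have hDL : MemLp D 2 μ := .of_discrete
  have hmeanD : μ[D] = 0 := by
    rw [integral_uniformOn_univ, Fintype.card_fin]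
    simpa [hD] using congrArg (Rat.cast : ℚ → ℝ) hmean
  have hvarD : Var[D; μ] ≠ 0 := by
    intro h
    have hae := ae_eq_integral_of_variance_eq_zero hDL h
    have hall (i : Fin m) : D i = μ[D] := by
      by_contra hi
      have hz : μ {i} = 0 := measure_mono_null (by simpa using hi) hae
      simp [hμ, uniformOn_eq_zero_iff Set.finite_univ] at hz
    obtain ⟨i, j, hij⟩ := hdistinct
    exact hij (Int.cast_injective (α := ℝ) ((hall i).trans (hall j).symm))
  have hlaw (n : ℕ) (p : ℝ → Prop) (q : ℤ → Prop) (hpq : ∀ z : ℤ, q z ↔ p z) :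
      (prob (fun f : Fin n → Fin m => q (sumRolls X f)) : ℝ) =
        P.real {ω | p (∑ k ∈ Finset.range n, Y k ω)} := by
    rw [prob_eq_uniformOn_real, ← Set.pi_univ Set.univ, uniformOn_pi, ← infinitePi_map_fin μ,
      map_measureReal_apply (by fun_prop) (.of_discrete)]
    congr 1
    ext ω
    simp [hpq, sumRolls, hYdef, hD, Finset.sum_range]
  have hmain := tendsto_measureReal_sum_pos_sub_neg ((hident 0).memLp_iff.2 hDL)
    ((hident 0).integral_eq.trans hmeanD) ((hident 0).variance_eq ▸ hvarD) hindep
    fun k => (hident k).trans (hident 0).symm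
  refine hmain.congr fun n => ?_
  rw [hlaw n (0 < ·) (0 < ·) (by simp), hlaw n (· < 0) (· < 0) (by simp)]
end
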